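/- arXiv:2103.16904 — 7 statements merged into one kernel-verified Lean document; each statement's English description precedes it below -/
import Mathlib

section
/- Let F be an algebraically closed field and let (f, g) be a pair of homogeneous polynomials of degree d ≥ 2 over F defining a separable simple morphism (f : g) : P^1 → P^1. Then the double point polynomial Δ of (f, g) is irreducible in the polynomial ring F[x_0, x_1, y_0, y_1]. -/
open MvPolynomial

noncomputable section

def wronskian2 (K : Type) [Field K] (f g : MvPolynomial (Fin 2) K) : MvPolynomial (Fin 2) K :=
  pderiv 0 f * pderiv 1 g - pderiv 1 f * pderiv 0 g

def linForm (K : Type) [Field K] (c d : K) : MvPolynomial (Fin 2) K :=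
  C d * X 0 - C c * X 1

/-- Simplicity over an algebraically closed field `K` (so that `K̄ = K`). -/
def IsSimplePair' (K : Type) [Field K] (f g : MvPolynomial (Fin 2) K) : Prop :=
  ∀ a b : K, (a, b) ≠ (0, 0) →
    (∀ c d : K, (c, d) ≠ (0, 0) → ¬ (linForm K c d) ^ 3 ∣ (C b * f - C a * g)) ∧
    (∀ c d c' d' : K, (c, d) ≠ (0, 0) → (c', d') ≠ (0, 0) →
      (linForm K c d) ^ 2 ∣ (C b * f - C a * g) →
      (linForm K c' d') ^ 2 ∣ (C b * f - C a * g) → c * d' = c' * d)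

/-! Homogeneity of factors -/

def gradeMap {σ K : Type} [Field K] (w : σ → ℕ) :
    MvPolynomial σ K →ₐ[K] Polynomial (MvPolynomial σ K) :=
  aeval (fun i => Polynomial.C (X i) * Polynomial.X ^ (w i))

lemma gradeMap_monomial {σ K : Type} [Field K] (w : σ → ℕ) (d : σ →₀ ℕ) (r : K) :
    gradeMap w (monomial d r) = Polynomial.monomial (Finsupp.weight w d) (monomial d r) := by
  rw [gradeMap, aeval_monomial, ← Polynomial.C_mul_X_pow_eq_monomial, monomial_eq (s := d)]
  simp only [mul_pow, Finsupp.prod, Finset.prod_mul_distrib, map_mul, map_prod, map_pow,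
    ← pow_mul, Finset.prod_pow_eq_pow_sum, Finsupp.weight_apply, Finsupp.sum, smul_eq_mul]
  rw [← mul_assoc]
  simp only [mul_comm (w _)]
  rfl

lemma gradeMap_coeff {σ K : Type} [Field K] (w : σ → ℕ) (p : MvPolynomial σ K) (k : ℕ) :
    (gradeMap w p).coeff k = weightedHomogeneousComponent w k p := by
  classical
  induction p using MvPolynomial.induction_on' with
  | monomial d r =>
    rw [gradeMap_monomial, Polynomial.coeff_monomial]
    ext e
    rw [coeff_weightedHomogeneousComponent]
    split_ifs with h1 h2 h2
    · rfl
    · rw [coeff_monomial, if_neg]; rintro rfl; exact h2 h1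
    · rw [coeff_monomial, if_neg, coeff_zero]; rintro rfl; exact h1 h2
    · simp
  | add p q hp hq => simp [hp, hq]

lemma wh_of_gradeMap {σ K : Type} [Field K] (w : σ → ℕ) (p : MvPolynomial σ K) (k : ℕ)
    (h : ∀ j, j ≠ k → (gradeMap w p).coeff j = 0) : IsWeightedHomogeneous w p k := by
  classical
  intro d hd
  by_contra hne
  have := h _ hne
  rw [gradeMap_coeff] at this
  have h2 := congrArg (coeff d) this
  rw [coeff_weightedHomogeneousComponent, if_pos rfl] at h2
  exact hd (by simpa using h2)

lemma gradeMap_of_wh {σ K : Type} [Field K] (w : σ → ℕ) (p : MvPolynomial σ K) (k : ℕ)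
    (h : IsWeightedHomogeneous w p k) : gradeMap w p = Polynomial.monomial k p := by
  classical
  ext j : 1
  rw [gradeMap_coeff, Polynomial.coeff_monomial]
  ext e
  rw [coeff_weightedHomogeneousComponent]
  by_cases he : coeff e p = 0
  · split_ifs <;> simp [he]
  · have := h he
    subst this
    split_ifs <;> simp

lemma wh_factor {σ K : Type} [Field K] (w : σ → ℕ) {A B D : MvPolynomial σ K} {n : ℕ}
    (h : D = A * B) (hD : D ≠ 0) (hDh : IsWeightedHomogeneous w D n) :
    ∃ k l, k + l = n ∧ IsWeightedHomogeneous w A k ∧ IsWeightedHomogeneous w B l := by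
  have h1 : gradeMap w A * gradeMap w B = Polynomial.monomial n D := by
    rw [← map_mul, ← h, gradeMap_of_wh w D n hDh]
  have hne : gradeMap w A * gradeMap w B ≠ 0 := by
    rw [h1]; simpa using hD
  have hA := left_ne_zero_of_mul hne
  have hB := right_ne_zero_of_mul hne
  have e1 := Polynomial.natDegree_mul hA hB
  have e2 := Polynomial.natTrailingDegree_mul hA hB
  rw [h1, Polynomial.natDegree_monomial_eq _ hD] at e1
  rw [h1, Polynomial.natTrailingDegree_monomial hD] at e2
  have l1 := Polynomial.natTrailingDegree_le_natDegree (gradeMap w A)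
  have l2 := Polynomial.natTrailingDegree_le_natDegree (gradeMap w B)
  refine ⟨_, _, e1.symm, wh_of_gradeMap w A _ ?_, wh_of_gradeMap w B _ ?_⟩
  · intro j hj
    rcases lt_or_gt_of_ne hj with hj | hj
    · exact Polynomial.coeff_eq_zero_of_lt_natTrailingDegree (by omega)
    · exact Polynomial.coeff_eq_zero_of_natDegree_lt hj
  · intro j hj
    rcases lt_or_gt_of_ne hj with hj | hj
    · exact Polynomial.coeff_eq_zero_of_lt_natTrailingDegree (by omega)
    · exact Polynomial.coeff_eq_zero_of_natDegree_lt hj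

lemma wh_aeval {σ τ K : Type} [Field K] (w : σ → ℕ) (w' : τ → ℕ) {p : MvPolynomial σ K} {n : ℕ}
    (hp : IsWeightedHomogeneous w p n) (ψ : σ → MvPolynomial τ K)
    (hψ : ∀ i, IsWeightedHomogeneous w' (ψ i) (w i)) :
    IsWeightedHomogeneous w' (aeval ψ p) n := by
  rw [aeval_def, eval₂_eq]
  refine IsWeightedHomogeneous.sum _ _ _ fun d hd => ?_
  refine IsWeightedHomogeneous.C_mul ?_ _
  have := hp (mem_support_iff.mp hd)
  rw [← this, Finsupp.weight_apply, Finsupp.sum]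
  exact IsWeightedHomogeneous.prod _ _ _ fun i _ => (hψ i).pow _

/-! Binary forms -/

lemma linForm_dvd {K : Type} [Field K] {p : MvPolynomial (Fin 2) K} {n : ℕ}
    (hp : p.IsHomogeneous n) (c d : K) (hcd : (c, d) ≠ (0, 0))
    (h0 : eval ![c, d] p = 0) : linForm K c d ∣ p := by
  have key : ∀ (s : K) (z : MvPolynomial (Fin 2) K), s ≠ 0 →
      (∀ i, linForm K c d ∣ C s * X i - C (![c, d] i) * z) → linForm K c d ∣ p := by
    intro s z hs hi
    have h1 : linForm K c d ∣ C (s ^ n) * p := by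
      rw [← Ideal.mem_span_singleton, ← Ideal.Quotient.eq_zero_iff_mem]
      set q := Ideal.Quotient.mkₐ K (Ideal.span {linForm K c d}) with hq
      change q _ = 0
      have e1 : ∀ (t : MvPolynomial (Fin 2) K) (v : Fin 2 → MvPolynomial (Fin 2) K),
          aeval (fun i => t * v i) p = t ^ n * aeval v p := by
        intro t v
        rw [aeval_def, eval₂_eq, aeval_def, eval₂_eq, Finset.mul_sum]
        refine Finset.sum_congr rfl fun e he => ?_
        have := hp (mem_support_iff.mp he)
        simp only [mul_pow, Finset.prod_mul_distrib, Finset.prod_pow_eq_pow_sum]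
        have h3 : ∑ i ∈ e.support, e i = n := by
          rw [← this, Finsupp.weight_apply, Finsupp.sum]; simp
        rw [h3]; ring
      have e2 : C (s ^ n) * p = aeval (fun i => C s * X i) p := by
        rw [e1, aeval_X_left_apply, map_pow]
      have e3 : q (aeval (fun i => C s * X i) p) = q (aeval (fun i => z * C (![c, d] i)) p) := by
        rw [← AlgHom.comp_apply, ← AlgHom.comp_apply]
        congr 1
        ext i
        simp only [AlgHom.comp_apply, aeval_X]
        rw [← sub_eq_zero, ← map_sub]
        change Ideal.Quotient.mk _ _ = 0
        rw [Ideal.Quotient.eq_zero_iff_mem, Ideal.mem_span_singleton, mul_comm z]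
        exact hi i
      have e4 : aeval (fun i => (C (![c, d] i) : MvPolynomial (Fin 2) K)) p = 0 := by
        have : aeval (fun i => (C (![c, d] i) : MvPolynomial (Fin 2) K)) p
            = C (eval ![c, d] p) := by
          rw [aeval_def, eval₂_eq, eval_eq]
          simp [algebraMap_eq]
        rw [this, h0, map_zero]
      rw [e2, e3, e1, e4, mul_zero, map_zero]
    have hu : IsUnit (C (s ^ n) : MvPolynomial (Fin 2) K) :=
      (IsUnit.mk0 _ (pow_ne_zero _ hs)).map C
    exact (hu.dvd_mul_left).mp h1
  by_cases hc : c = 0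
  · have hd : d ≠ 0 := by rintro rfl; exact hcd (by rw [hc])
    refine key d (X 1) hd fun i => ?_
    fin_cases i
    · exact ⟨1, by simp [linForm]⟩
    · simp
  · refine key c (X 0) hc fun i => ?_
    fin_cases i
    · simp
    · exact ⟨-1, by simp [linForm]⟩

def dehom {K : Type} [Field K] (p : MvPolynomial (Fin 2) K) : Polynomial K :=
  aeval ![Polynomial.X, 1] p

lemma dehom_eval {K : Type} [Field K] (p : MvPolynomial (Fin 2) K) (t : K) :
    (dehom p).eval t = eval ![t, 1] p := by
  have : ((Polynomial.aeval t).comp (aeval ![Polynomial.X, 1]) :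
      MvPolynomial (Fin 2) K →ₐ[K] K) = aeval ![t, 1] := by
    ext i : 1
    fin_cases i <;> simp
  exact DFunLike.congr_fun this p

lemma dehom_term {K : Type} [Field K] (r : K) (e : Fin 2 →₀ ℕ) :
    (algebraMap K (Polynomial K)) r * ∏ i, ![Polynomial.X, 1] i ^ e i
      = Polynomial.monomial (e 0) r := by
  rw [← Polynomial.C_mul_X_pow_eq_monomial, Fin.prod_univ_two]
  simp

lemma dehom_natDegree {K : Type} [Field K] {p : MvPolynomial (Fin 2) K} {n : ℕ}
    (hp : p.IsHomogeneous n) : (dehom p).natDegree ≤ n := by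
  rw [dehom, aeval_def, eval₂_eq']
  refine Polynomial.natDegree_sum_le_of_forall_le _ _ fun e he => ?_
  have := hp (mem_support_iff.mp he)
  simp [Finsupp.weight_apply, Finsupp.sum_fintype] at this
  rw [dehom_term]
  exact (Polynomial.natDegree_monomial_le _).trans (by omega)

lemma dehom_coeff {K : Type} [Field K] {p : MvPolynomial (Fin 2) K} {n : ℕ}
    (hp : p.IsHomogeneous n) : (dehom p).coeff n = eval ![1, 0] p := by
  rw [dehom, aeval_def, eval₂_eq', eval_eq', Polynomial.finsetSum_coeff]
  refine Finset.sum_congr rfl fun e he => ?_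
  have := hp (mem_support_iff.mp he)
  simp [Finsupp.weight_apply, Finsupp.sum_fintype] at this
  rw [dehom_term, Polynomial.coeff_monomial]
  by_cases h : e 1 = 0
  · rw [if_pos (by omega)]; simp [h]
  · rw [if_neg (by omega)]; simp [h]

lemma exists_zero {K : Type} [Field K] [IsAlgClosed K] {p : MvPolynomial (Fin 2) K} {n : ℕ}
    (hp : p.IsHomogeneous n) (hn : 0 < n) :
    ∃ c d : K, (c, d) ≠ (0, 0) ∧ eval ![c, d] p = 0 := by
  by_cases h : (dehom p).degree = 0
  · refine ⟨1, 0, by simp, ?_⟩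
    rw [← dehom_coeff hp]
    apply Polynomial.coeff_eq_zero_of_degree_lt
    rw [h]; exact_mod_cast hn
  · obtain ⟨t, ht⟩ := IsAlgClosed.exists_root _ h
    exact ⟨t, 1, by simp, by rw [← dehom_eval]; exact ht⟩

lemma common_root_aux {K : Type} [Field K] [IsAlgClosed K] {p q : Polynomial K} {m n : ℕ}
    (hp : p.natDegree ≤ m) (hq : q.natDegree ≤ n) (h : p.resultant q m n = 0)
    (hm : p.coeff m ≠ 0) : ∃ t, p.eval t = 0 ∧ q.eval t = 0 := by
  have hm' : p.natDegree = m := le_antisymm hp (Polynomial.le_natDegree_of_ne_zero hm)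
  have hp0 : p ≠ 0 := by rintro rfl; simp at hm
  subst hm'
  rw [Polynomial.resultant_eq_prod_eval p q n hq (IsAlgClosed.splits p)] at h
  have h2 := (mul_eq_zero.mp h).resolve_left (pow_ne_zero _ hm)
  rw [Multiset.prod_eq_zero_iff, Multiset.mem_map] at h2
  obtain ⟨t, ht, h3⟩ := h2
  exact ⟨t, (Polynomial.mem_roots hp0).mp ht, h3⟩

lemma common_root {K : Type} [Field K] [IsAlgClosed K] {p q : Polynomial K} {m n : ℕ}
    (hp : p.natDegree ≤ m) (hq : q.natDegree ≤ n) (h : p.resultant q m n = 0) :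
    (∃ t, p.eval t = 0 ∧ q.eval t = 0) ∨ (p.coeff m = 0 ∧ q.coeff n = 0) := by
  by_cases hm : p.coeff m = 0
  · by_cases hn : q.coeff n = 0
    · exact Or.inr ⟨hm, hn⟩
    · left
      rw [Polynomial.resultant_comm] at h
      have h2 := (mul_eq_zero.mp h).resolve_left (pow_ne_zero _ (by simp))
      obtain ⟨t, h3, h4⟩ := common_root_aux hq hp h2 hn
      exact ⟨t, h4, h3⟩
  · exact Or.inl (common_root_aux hp hq h hm)

lemma resultant_homog {K : Type} [Field K] {P Q : Polynomial (MvPolynomial (Fin 2) K)}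
    {m n a b : ℕ} (hP : ∀ k, (P.coeff k).IsHomogeneous a)
    (hQ : ∀ k, (Q.coeff k).IsHomogeneous b) :
    (P.resultant Q m n).IsHomogeneous (m * b + n * a) := by
  rw [Polynomial.resultant, Matrix.det_apply]
  refine IsHomogeneous.sum _ _ _ fun s _ => ?_
  have : (∏ i, Polynomial.sylvester P Q m n (s i) i).IsHomogeneous (m * b + n * a) := by
    have h2 : m * b + n * a =
        ∑ i : Fin (m + n), Fin.addCases (fun _ => b) (fun _ => a) i := by
      simp [Fin.sum_univ_add]
    rw [h2]
    refine IsHomogeneous.prod _ _ _ fun i _ => ?_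
    induction i using Fin.addCases with
    | left i =>
      simp only [Polynomial.sylvester, Matrix.of_apply, Fin.addCases_left]
      split_ifs
      · exact hQ _
      · exact isHomogeneous_zero _ _ _
    | right i =>
      simp only [Polynomial.sylvester, Matrix.of_apply, Fin.addCases_right]
      split_ifs
      · exact hP _
      · exact isHomogeneous_zero _ _ _
  rcases Int.units_eq_one_or (Equiv.Perm.sign s) with h | h
  · rw [h, one_smul]; exact this
  · rw [h, Units.neg_smul, one_smul]; exact this.neg

/-! Bihomogeneous forms -/

def wL : Fin 4 → ℕ := ![1, 1, 0, 0]
def wR : Fin 4 → ℕ := ![0, 0, 1, 1]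

/-- specialise the first pair of variables -/
def spL {K : Type} [Field K] (c d : K) : MvPolynomial (Fin 4) K →ₐ[K] MvPolynomial (Fin 2) K :=
  aeval ![C c, C d, X 0, X 1]

def spR {K : Type} [Field K] (c d : K) : MvPolynomial (Fin 4) K →ₐ[K] MvPolynomial (Fin 2) K :=
  aeval ![X 0, X 1, C c, C d]

lemma spL_homog {K : Type} [Field K] (c d : K) {A : MvPolynomial (Fin 4) K} {n : ℕ}
    (h : IsWeightedHomogeneous wR A n) : (spL c d A).IsHomogeneous n := by
  refine wh_aeval wR 1 h _ fun i => ?_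
  fin_cases i
  · exact isWeightedHomogeneous_C _ _
  · exact isWeightedHomogeneous_C _ _
  · exact isWeightedHomogeneous_X _ _ _
  · exact isWeightedHomogeneous_X _ _ _

lemma spR_homog {K : Type} [Field K] (c d : K) {A : MvPolynomial (Fin 4) K} {n : ℕ}
    (h : IsWeightedHomogeneous wL A n) : (spR c d A).IsHomogeneous n := by
  refine wh_aeval wL 1 h _ fun i => ?_
  fin_cases i
  · exact isWeightedHomogeneous_X _ _ _
  · exact isWeightedHomogeneous_X _ _ _
  · exact isWeightedHomogeneous_C _ _
  · exact isWeightedHomogeneous_C _ _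

lemma eval_spL {K : Type} [Field K] (c d s t : K) (A : MvPolynomial (Fin 4) K) :
    eval ![s, t] (spL c d A) = eval ![c, d, s, t] A := by
  simp only [← coe_aeval_eq_eval, RingHom.coe_coe]
  rw [← AlgHom.comp_apply]
  congr 1
  ext i
  fin_cases i <;> simp [spL]

lemma eval_spR {K : Type} [Field K] (c d s t : K) (A : MvPolynomial (Fin 4) K) :
    eval ![c, d] (spR s t A) = eval ![c, d, s, t] A := by
  simp only [← coe_aeval_eq_eval, RingHom.coe_coe]
  rw [← AlgHom.comp_apply]
  congr 1
  ext i
  fin_cases i <;> simp [spR]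

def univ4 {K : Type} [Field K] :
    MvPolynomial (Fin 4) K →ₐ[K] Polynomial (MvPolynomial (Fin 2) K) :=
  aeval ![Polynomial.C (X 0), Polynomial.C (X 1), Polynomial.X, 1]

lemma univ4_map {K : Type} [Field K] (c d : K) (A : MvPolynomial (Fin 4) K) :
    (univ4 A).map (eval ![c, d]) = dehom (spL c d A) := by
  have : ((Polynomial.mapAlgHom (aeval ![c, d])).comp univ4 :
      MvPolynomial (Fin 4) K →ₐ[K] Polynomial K) =
      (aeval ![Polynomial.X, 1]).comp (spL c d) := by
    ext i : 1
    fin_cases i <;> simp [spL, univ4]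
  exact DFunLike.congr_fun this A

lemma univ4_coeff {K : Type} [Field K] {A : MvPolynomial (Fin 4) K} {n : ℕ}
    (h : IsWeightedHomogeneous wL A n) (k : ℕ) : ((univ4 A).coeff k).IsHomogeneous n := by
  rw [univ4, aeval_def, eval₂_eq', Polynomial.finsetSum_coeff]
  refine IsHomogeneous.sum _ _ _ fun e he => ?_
  have h1 := h (mem_support_iff.mp he)
  simp [Finsupp.weight_apply, Finsupp.sum_fintype, Fin.sum_univ_four, wL] at h1
  have : (algebraMap K (Polynomial (MvPolynomial (Fin 2) K))) (coeff e A) *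
      ∏ i, ![Polynomial.C (X 0), Polynomial.C (X 1), Polynomial.X, 1] i ^ e i
      = Polynomial.monomial (e 2) (C (coeff e A) * (X 0 ^ e 0 * X 1 ^ e 1)) := by
    rw [← Polynomial.C_mul_X_pow_eq_monomial, Fin.prod_univ_four]
    simp [algebraMap_eq, mul_assoc]
  rw [this, Polynomial.coeff_monomial]
  split_ifs
  · rw [← h1]
    exact (((isHomogeneous_X_pow _ _).mul (isHomogeneous_X_pow _ _))).C_mul _
  · exact isHomogeneous_zero _ _ _

lemma bezout {K : Type} [Field K] [IsAlgClosed K] {A B : MvPolynomial (Fin 4) K}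
    {a1 a2 b1 b2 : ℕ} (hA1 : IsWeightedHomogeneous wL A a1) (hA2 : IsWeightedHomogeneous wR A a2)
    (hB1 : IsWeightedHomogeneous wL B b1) (hB2 : IsWeightedHomogeneous wR B b2)
    (hpos : 0 < a2 * b1 + b2 * a1) :
    ∃ c d s t : K, (c, d) ≠ (0, 0) ∧ (s, t) ≠ (0, 0) ∧
      eval ![c, d, s, t] A = 0 ∧ eval ![c, d, s, t] B = 0 := by
  obtain ⟨c, d, hcd, h0⟩ := exists_zero
    (resultant_homog (m := a2) (n := b2) (univ4_coeff hA1) (univ4_coeff hB1)) hpos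
  rw [← Polynomial.resultant_map_map, univ4_map, univ4_map] at h0
  have hA := spL_homog c d hA2
  have hB := spL_homog c d hB2
  rcases common_root (dehom_natDegree hA) (dehom_natDegree hB) h0 with ⟨t, h1, h2⟩ | ⟨h1, h2⟩
  · rw [dehom_eval, eval_spL] at h1 h2
    exact ⟨c, d, t, 1, hcd, by simp, h1, h2⟩
  · rw [dehom_coeff hA, eval_spL] at h1
    rw [dehom_coeff hB, eval_spL] at h2
    exact ⟨c, d, 1, 0, hcd, by simp, h1, h2⟩

lemma sp_fst {K : Type} [Field K] (s t : K) (f : MvPolynomial (Fin 2) K) :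
    spR s t (aeval ![X 0, X 1] f) = f ∧ spR s t (aeval ![X 2, X 3] f) = C (eval ![s, t] f) ∧
    spL s t (aeval ![X 2, X 3] f) = f ∧ spL s t (aeval ![X 0, X 1] f) = C (eval ![s, t] f) := by
  have hC : aeval ![(C s : MvPolynomial (Fin 2) K), C t] f = C (eval ![s, t] f) := by
    have : (aeval ![(C s : MvPolynomial (Fin 2) K), C t] : MvPolynomial (Fin 2) K →ₐ[K] _) =
        (Algebra.ofId K (MvPolynomial (Fin 2) K)).comp (aeval ![s, t]) := by
      ext i : 1
      fin_cases i <;> simp [Algebra.ofId_apply, algebraMap_eq]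
    exact DFunLike.congr_fun this f
  have hX : aeval ![(X 0 : MvPolynomial (Fin 2) K), X 1] f = f := by
    have : (aeval ![(X 0 : MvPolynomial (Fin 2) K), X 1] : MvPolynomial (Fin 2) K →ₐ[K] _) =
        AlgHom.id K _ := by
      ext i : 1
      fin_cases i <;> simp
    exact DFunLike.congr_fun this f
  refine ⟨?_, ?_, ?_, ?_⟩
  · refine Eq.trans ?_ hX
    rw [← AlgHom.comp_apply]; congr 1; ext i : 1; fin_cases i <;> simp [spR]
  · refine Eq.trans ?_ hC
    rw [← AlgHom.comp_apply]; congr 1; ext i : 1; fin_cases i <;> simp [spR]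
  · refine Eq.trans ?_ hX
    rw [← AlgHom.comp_apply]; congr 1; ext i : 1; fin_cases i <;> simp [spL]
  · refine Eq.trans ?_ hC
    rw [← AlgHom.comp_apply]; congr 1; ext i : 1; fin_cases i <;> simp [spL]

lemma wh_pair {K : Type} [Field K] {d : ℕ} {f : MvPolynomial (Fin 2) K} (hf : f.IsHomogeneous d) :
    IsWeightedHomogeneous wL (aeval ![(X 0 : MvPolynomial (Fin 4) K), X 1] f) d ∧
    IsWeightedHomogeneous wL (aeval ![(X 2 : MvPolynomial (Fin 4) K), X 3] f) 0 ∧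
    IsWeightedHomogeneous wR (aeval ![(X 0 : MvPolynomial (Fin 4) K), X 1] f) 0 ∧
    IsWeightedHomogeneous wR (aeval ![(X 2 : MvPolynomial (Fin 4) K), X 3] f) d := by
  have h0 : IsWeightedHomogeneous (0 : Fin 2 → ℕ) f 0 := by
    intro e _
    simp [Finsupp.weight_apply]
  refine ⟨wh_aeval 1 wL hf _ ?_, wh_aeval 0 wL h0 _ ?_, wh_aeval 0 wR h0 _ ?_,
    wh_aeval 1 wR hf _ ?_⟩ <;>
  · intro i
    fin_cases i <;> exact isWeightedHomogeneous_X _ _ _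

theorem stmt3 (F : Type) [Field F] [IsAlgClosed F] (d : ℕ) (hd : 2 ≤ d)
    (f g : MvPolynomial (Fin 2) F)
    (hf : f.IsHomogeneous d) (hg : g.IsHomogeneous d)
    (hmor : ∀ a b : F, (a, b) ≠ (0, 0) → ¬ (eval ![a, b] f = 0 ∧ eval ![a, b] g = 0))
    (hsep : wronskian2 F f g ≠ 0)
    (hsimp : IsSimplePair' F f g)
    (Δ : MvPolynomial (Fin 4) F)
    (hΔ : (X 0 * X 3 - X 1 * X 2) * Δ =
      aeval ![X 0, X 1] f * aeval ![X 2, X 3] g - aeval ![X 2, X 3] f * aeval ![X 0, X 1] g) :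
    Irreducible Δ := by
  have hR : ∀ s t : F, linForm F s t * spR s t Δ =
      C (eval ![s, t] g) * f - C (eval ![s, t] f) * g := by
    intro s t
    have h := congrArg (spR s t) hΔ
    rw [map_mul, map_sub (spR s t) (aeval _ f * _), map_mul, map_mul, (sp_fst s t f).1,
      (sp_fst s t g).1, (sp_fst s t f).2.1, (sp_fst s t g).2.1] at h
    rw [mul_comm (C (eval ![s, t] g)), ← h]
    congr 1
    simp [spR, linForm]
    ring
  have hL : ∀ s t : F, linForm F s t * spL s t Δ =
      C (eval ![s, t] g) * f - C (eval ![s, t] f) * g := by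
    intro s t
    have h := congrArg (spL s t) hΔ
    rw [map_mul, map_sub (spL s t) (aeval _ f * _), map_mul, map_mul, (sp_fst s t f).2.2.1,
      (sp_fst s t g).2.2.1, (sp_fst s t f).2.2.2, (sp_fst s t g).2.2.2] at h
    have h2 : spL s t (X 0 * X 3 - X 1 * X 2) = - linForm F s t := by
      simp [spL, linForm]
    rw [h2] at h
    linear_combination -h
  have hab : ∀ s t : F, (s, t) ≠ (0, 0) → (eval ![s, t] f, eval ![s, t] g) ≠ (0, 0) := by
    intro s t hst h
    rw [Prod.mk.injEq] at h
    exact hmor s t hst h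
  have hΔ0 : Δ ≠ 0 := by
    rintro rfl
    have h := hR 1 0
    rw [map_zero, mul_zero] at h
    exact (hsimp _ _ (hab 1 0 (by simp))).1 1 0 (by simp) (h ▸ dvd_zero _)
  have hlin0 : (X 0 * X 3 - X 1 * X 2 : MvPolynomial (Fin 4) F) ≠ 0 := by
    intro h
    have := congrArg (eval ![1, 0, 0, 1]) h
    simp at this
  have hP0 := mul_ne_zero hlin0 hΔ0
  have hlinL : IsWeightedHomogeneous wL (X 0 * X 3 - X 1 * X 2 : MvPolynomial (Fin 4) F) 1 :=
    ((isWeightedHomogeneous_X F wL 0).mul (isWeightedHomogeneous_X F wL 3)).sub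
      ((isWeightedHomogeneous_X F wL 1).mul (isWeightedHomogeneous_X F wL 2))
  have hlinR : IsWeightedHomogeneous wR (X 0 * X 3 - X 1 * X 2 : MvPolynomial (Fin 4) F) 1 :=
    ((isWeightedHomogeneous_X F wR 0).mul (isWeightedHomogeneous_X F wR 3)).sub
      ((isWeightedHomogeneous_X F wR 1).mul (isWeightedHomogeneous_X F wR 2))
  have hΔL : IsWeightedHomogeneous wL Δ (d - 1) := by
    have hPL : IsWeightedHomogeneous wL ((X 0 * X 3 - X 1 * X 2) * Δ) d := by
      rw [hΔ]
      have h1 := (wh_pair hf).1.mul (wh_pair hg).2.1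
      have h2 := (wh_pair hf).2.1.mul (wh_pair hg).1
      rw [add_zero] at h1
      rw [zero_add] at h2
      exact h1.sub h2
    obtain ⟨k, l, hkl, hk, hl⟩ := wh_factor wL rfl hP0 hPL
    have := hk.inj_right hlin0 hlinL
    have e : d - 1 = l := by omega
    rw [e]; exact hl
  have hΔR : IsWeightedHomogeneous wR Δ (d - 1) := by
    have hPR : IsWeightedHomogeneous wR ((X 0 * X 3 - X 1 * X 2) * Δ) d := by
      rw [hΔ]
      have h1 := (wh_pair hf).2.2.1.mul (wh_pair hg).2.2.2
      have h2 := (wh_pair hf).2.2.2.mul (wh_pair hg).2.2.1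
      rw [zero_add] at h1
      rw [add_zero] at h2
      exact h1.sub h2
    obtain ⟨k, l, hkl, hk, hl⟩ := wh_factor wR rfl hP0 hPR
    have := hk.inj_right hlin0 hlinR
    have e : d - 1 = l := by omega
    rw [e]; exact hl
  have hunit : ∀ A : MvPolynomial (Fin 4) F, A ≠ 0 → IsWeightedHomogeneous wL A 0 →
      IsWeightedHomogeneous wR A 0 → IsUnit A := by
    intro A hA0 h1 h2
    have hc : A = C (coeff 0 A) := by
      ext e
      rw [coeff_C]
      split_ifs with he
      · rw [he]
      · by_contra hne
        have w1 := h1 hne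
        have w2 := h2 hne
        simp [Finsupp.weight_apply, Finsupp.sum_fintype, Fin.sum_univ_four, wL, wR] at w1 w2
        apply he
        ext i
        fin_cases i
        · exact w1.1.symm
        · exact w1.2.symm
        · exact w2.1.symm
        · exact w2.2.symm
    have hne : coeff 0 A ≠ 0 := by
      intro h; rw [h, map_zero] at hc; exact hA0 hc
    rw [hc]
    exact (IsUnit.mk0 _ hne).map C
  constructor
  · intro hu
    rw [MvPolynomial.isUnit_iff_eq_C_of_isReduced] at hu
    obtain ⟨r, _, hr⟩ := hu
    have := hΔL.inj_right hΔ0 (by rw [hr]; exact isWeightedHomogeneous_C wL r)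
    omega
  · intro A B hAB
    have hA0 : A ≠ 0 := by rintro rfl; exact hΔ0 (by rw [hAB, zero_mul])
    have hB0 : B ≠ 0 := by rintro rfl; exact hΔ0 (by rw [hAB, mul_zero])
    obtain ⟨a1, b1, h1, hA1, hB1⟩ := wh_factor wL hAB hΔ0 hΔL
    obtain ⟨a2, b2, h2, hA2, hB2⟩ := wh_factor wR hAB hΔ0 hΔR
    rcases Nat.eq_zero_or_pos (a2 * b1 + b2 * a1) with hz | hpos
    · obtain ⟨z1, z2⟩ := Nat.add_eq_zero_iff.mp hz
      rcases Nat.mul_eq_zero.mp z1 with h | h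
      · rcases Nat.mul_eq_zero.mp z2 with h' | h'
        · omega
        · left; subst h h'; exact hunit A hA0 hA1 hA2
      · rcases Nat.mul_eq_zero.mp z2 with h' | h'
        · right; subst h h'; exact hunit B hB0 hB1 hB2
        · omega
    · exfalso
      obtain ⟨c, e, s, t, hce, hst, eA, eB⟩ := bezout hA1 hA2 hB1 hB2 hpos
      have dRA := linForm_dvd (spR_homog s t hA1) c e hce (by rw [eval_spR]; exact eA)
      have dRB := linForm_dvd (spR_homog s t hB1) c e hce (by rw [eval_spR]; exact eB)
      have dLA := linForm_dvd (spL_homog c e hA2) s t hst (by rw [eval_spL]; exact eA)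
      have dLB := linForm_dvd (spL_homog c e hB2) s t hst (by rw [eval_spL]; exact eB)
      have hR' := hR s t
      have hL' := hL c e
      rw [hAB, map_mul] at hR' hL'
      have dR : linForm F c e ^ 2 ∣ C (eval ![s, t] g) * f - C (eval ![s, t] f) * g := by
        rw [← hR', pow_two]
        exact (mul_dvd_mul dRA dRB).mul_left _
      have dL : linForm F s t ^ 2 ∣ C (eval ![c, e] g) * f - C (eval ![c, e] f) * g := by
        rw [← hL', pow_two]
        exact (mul_dvd_mul dLA dLB).mul_left _
      have hnp : c * t ≠ s * e := by
        intro hpar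
        have hlh : (linForm F s t).IsHomogeneous 1 :=
          ((isHomogeneous_X F 0).C_mul t).sub ((isHomogeneous_X F 1).C_mul s)
        have d1 : linForm F c e ∣ linForm F s t := by
          refine linForm_dvd hlh c e hce ?_
          simp [linForm]
          linear_combination hpar
        refine (hsimp _ _ (hab s t hst)).1 c e hce ?_
        rw [← hR', pow_succ, pow_two, mul_comm (linForm F c e * linForm F c e)]
        exact mul_dvd_mul d1 (mul_dvd_mul dRA dRB)
      have hcross : eval ![s, t] g * eval ![c, e] f = eval ![s, t] f * eval ![c, e] g := by
        have h := congrArg (eval ![c, e]) hR'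
        rw [map_mul, map_mul, eval_spR, eval_spR, eA] at h
        simp at h
        linear_combination -h
      have hcrossC : (C (eval ![s, t] g) * C (eval ![c, e] f) : MvPolynomial (Fin 2) F) =
          C (eval ![s, t] f) * C (eval ![c, e] g) := by
        rw [← map_mul, ← map_mul, hcross]
      have dR2 : linForm F s t ^ 2 ∣ C (eval ![s, t] g) * f - C (eval ![s, t] f) * g := by
        by_cases hfc : eval ![c, e] f = 0
        · have hgc : eval ![c, e] g ≠ 0 := fun h => hmor c e hce ⟨hfc, h⟩
          have hu : IsUnit (C (eval ![c, e] g) : MvPolynomial (Fin 2) F) :=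
            (IsUnit.mk0 _ hgc).map C
          rw [← hu.dvd_mul_left]
          have : C (eval ![c, e] g) * (C (eval ![s, t] g) * f - C (eval ![s, t] f) * g) =
              C (eval ![s, t] g) * (C (eval ![c, e] g) * f - C (eval ![c, e] f) * g) := by
            linear_combination g * hcrossC
          rw [this]
          exact dL.mul_left _
        · have hu : IsUnit (C (eval ![c, e] f) : MvPolynomial (Fin 2) F) :=
            (IsUnit.mk0 _ hfc).map C
          rw [← hu.dvd_mul_left]
          have : C (eval ![c, e] f) * (C (eval ![s, t] g) * f - C (eval ![s, t] f) * g) =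
              C (eval ![s, t] f) * (C (eval ![c, e] g) * f - C (eval ![c, e] f) * g) := by
            linear_combination f * hcrossC
          rw [this]
          exact dL.mul_left _
      exact hnp ((hsimp _ _ (hab s t hst)).2 c e s t hce hst dR dR2)


end
end

section
/- For every prime power q: no plane of P^3(F_q) contains more than three points of C_3(q); the number of planes containing exactly three points of C_3(q) is q(q^2−1)/6; the number containing exactly two points is q(q+1); the number containing exactly one point is (q+1) + q(q^2−1)/2; and the number containing no point of C_3(q) is q(q^2−1)/3. -/
open Submodule Module

noncomputable section

variable (F : Type) [Field F]

/-- The points of the twisted cubic `C₃(q)` in `P³(F_q)`, viewed as 1-dimensional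
subspaces of `F_q⁴`: the points `(t³ : t² : t : 1)` for `t ∈ F_q` together with
`(1 : 0 : 0 : 0)`. -/
def cubicPts : Set (Submodule F (Fin 4 → F)) :=
  {P | (∃ t : F, P = span F {![t ^ 3, t ^ 2, t, 1]}) ∨ P = span F {![1, 0, 0, 0]}}

/-- The points of the twisted cubic lying on a given subspace `W`. -/
def ptsOn (W : Submodule F (Fin 4 → F)) : Set (Submodule F (Fin 4 → F)) :=
  {P | P ∈ cubicPts F ∧ P ≤ W}

/-- A 3-plane: a plane of `P³(F_q)` containing exactly three points of `C₃(q)`. -/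
def IsThreePlane (W : Submodule F (Fin 4 → F)) : Prop :=
  finrank F W = 3 ∧ (ptsOn F W).ncard = 3

/-- A real chord: a line containing two distinct points of `C₃(q)`. -/
def IsRealChord (L : Submodule F (Fin 4 → F)) : Prop :=
  finrank F L = 2 ∧ ∃ P Q, P ∈ cubicPts F ∧ Q ∈ cubicPts F ∧ P ≠ Q ∧ P ≤ L ∧ Q ≤ L

/-- The set of lines of `P³(F_q)` that are not real chords and are contained in at
least one 3-plane; `μ_q` is its cardinality. -/
def muSet : Set (Submodule F (Fin 4 → F)) :=
  {L | finrank F L = 2 ∧ ¬ IsRealChord F L ∧ ∃ W, IsThreePlane F W ∧ L ≤ W}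

/-- A tangent line of the twisted cubic: at `(t³ : t² : t : 1)` the line spanned by
`(t³, t², t, 1)` and `(3t², 2t, 1, 0)`, and at `(1:0:0:0)` the line spanned by
`(1,0,0,0)` and `(0,0,1,0)`. -/
def IsTangentLine (L : Submodule F (Fin 4 → F)) : Prop :=
  (∃ t : F, L = span F {![t ^ 3, t ^ 2, t, 1], ![3 * t ^ 2, 2 * t, 1, 0]}) ∨
    L = span F {![1, 0, 0, 0], ![0, 0, 1, 0]}

/-- Extension of scalars of a vector of `F⁴` to `E⁴`. -/
def extVec (E : Type) [Field E] [Algebra F E] (v : Fin 4 → F) : Fin 4 → E :=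
  fun i => algebraMap F E (v i)

/-- An imaginary chord: a line `L` of `P³(F_q)` such that the `F_{q²}`-span of `L`
contains the vector `(ξ³, ξ², ξ, 1)` for some `ξ ∈ F_{q²} ∖ F_q`. -/
def IsImagChord (E : Type) [Field E] [Algebra F E] (L : Submodule F (Fin 4 → F)) : Prop :=
  finrank F L = 2 ∧ ∃ ξ : E, ξ ∉ Set.range (algebraMap F E) ∧
    (![ξ ^ 3, ξ ^ 2, ξ, 1]) ∈ span E (extVec F E '' (L : Set (Fin 4 → F)))

/-- The linear form `X₀ − 3t X₁ + 3t² X₂ − t³ X₃` defining the osculating plane at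
`(t³ : t² : t : 1)`. -/
def oscForm (t : F) : (Fin 4 → F) →ₗ[F] F :=
  (LinearMap.proj 0 : (Fin 4 → F) →ₗ[F] F) - (3 * t) • (LinearMap.proj 1 : (Fin 4 → F) →ₗ[F] F)
    + (3 * t ^ 2) • (LinearMap.proj 2 : (Fin 4 → F) →ₗ[F] F)
    - t ^ 3 • (LinearMap.proj 3 : (Fin 4 → F) →ₗ[F] F)

/-- The osculating planes of the twisted cubic, indexed by `F ∪ {∞}` (`none = ∞`,
where the osculating plane is `X₃ = 0`). -/
def oscPlane : Option F → Submodule F (Fin 4 → F)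
  | some t => LinearMap.ker (oscForm F t)
  | none => LinearMap.ker (LinearMap.proj 3 : (Fin 4 → F) →ₗ[F] F)

/-- First homogeneous parameter. -/
def hX : Option F → F
  | some t => t
  | none => 1

/-- Second homogeneous parameter. -/
def hY : Option F → F
  | some _ => 1
  | none => 0

/-- The vector on the cubic. -/
def vv (a : Option F) : Fin 4 → F :=
  ![hX F a ^ 3, hX F a ^ 2 * hY F a, hX F a * hY F a ^ 2, hY F a ^ 3]

/-- A functional with the given coefficients. -/
def fun4 (a b c d : F) : Dual F (Fin 4 → F) :=
  a • (LinearMap.proj 0 : (Fin 4 → F) →ₗ[F] F) + b • (LinearMap.proj 1 : (Fin 4 → F) →ₗ[F] F)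
    + c • (LinearMap.proj 2 : (Fin 4 → F) →ₗ[F] F) + d • (LinearMap.proj 3 : (Fin 4 → F) →ₗ[F] F)

lemma fun4_vv (a b c d : F) (p : Option F) :
    fun4 F a b c d (vv F p) = a * hX F p ^ 3 + b * (hX F p ^ 2 * hY F p)
      + c * (hX F p * hY F p ^ 2) + d * hY F p ^ 3 := by
  simp [fun4, vv]

lemma det_ne {a b : Option F} (h : a ≠ b) : hX F a * hY F b - hX F b * hY F a ≠ 0 := by
  cases a <;> cases b <;> simp_all [hX, hY, sub_eq_zero]

lemma sep3 (a b c d : Option F) (hb : a ≠ b) (hc : a ≠ c) (hd : a ≠ d) :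
    ∃ φ : Dual F (Fin 4 → F), φ (vv F a) ≠ 0 ∧ φ (vv F b) = 0 ∧ φ (vv F c) = 0 ∧
      φ (vv F d) = 0 := by
  refine ⟨fun4 F (hY F b * hY F c * hY F d)
    (-(hX F b * hY F c * hY F d + hY F b * hX F c * hY F d + hY F b * hY F c * hX F d))
    (hX F b * hX F c * hY F d + hX F b * hY F c * hX F d + hY F b * hX F c * hX F d)
    (-(hX F b * hX F c * hX F d)), ?_, ?_, ?_, ?_⟩
  · rw [fun4_vv]
    have := mul_ne_zero (mul_ne_zero (det_ne F hb) (det_ne F hc)) (det_ne F hd)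
    convert! this using 1
    ring
  all_goals rw [fun4_vv]; ring

lemma sepT (a : Option F) (T : Finset (Option F)) (ha : a ∉ T) (hT : T.card ≤ 3) :
    ∃ φ : Dual F (Fin 4 → F), φ (vv F a) ≠ 0 ∧ ∀ b ∈ T, φ (vv F b) = 0 := by
  classical
  obtain h | h | h | h : T.card = 0 ∨ T.card = 1 ∨ T.card = 2 ∨ T.card = 3 := by omega
  · rw [Finset.card_eq_zero] at h
    obtain ⟨b, hb⟩ := exists_ne a
    obtain ⟨φ, h1, -⟩ := sep3 F a b b b hb.symm hb.symm hb.symm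
    exact ⟨φ, h1, by simp [h]⟩
  · obtain ⟨b, rfl⟩ := Finset.card_eq_one.1 h
    have hb : a ≠ b := by simpa using ha
    obtain ⟨φ, h1, h2, -⟩ := sep3 F a b b b hb hb hb
    exact ⟨φ, h1, by simp [h2]⟩
  · obtain ⟨b, c, -, rfl⟩ := Finset.card_eq_two.1 h
    simp only [Finset.mem_insert, Finset.mem_singleton, not_or] at ha
    obtain ⟨φ, h1, h2, h3, -⟩ := sep3 F a b c c ha.1 ha.2 ha.2
    exact ⟨φ, h1, by simp [h2, h3]⟩
  · obtain ⟨b, c, d, -, -, -, rfl⟩ := Finset.card_eq_three.1 h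
    simp only [Finset.mem_insert, Finset.mem_singleton, not_or] at ha
    obtain ⟨φ, h1, h2, h3, h4⟩ := sep3 F a b c d ha.1 ha.2.1 ha.2.2
    exact ⟨φ, h1, by simp [h2, h3, h4]⟩

lemma vv_indep (s : Finset (Option F)) (hs : s.card ≤ 4) :
    LinearIndepOn F (vv F) (s : Set (Option F)) := by
  classical
  rw [linearIndepOn_finset_iff]
  intro g hg a ha
  obtain ⟨φ, h1, h2⟩ := sepT F a (s.erase a) (by simp)
    (by rw [Finset.card_erase_of_mem ha]; omega)
  have h := congrArg φ hg
  rw [map_sum, Finset.sum_eq_single a] at h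
  · simpa [h1] using h
  · intro b hb hba
    simp [h2 b (Finset.mem_erase.2 ⟨hba, hb⟩)]
  · exact fun h => absurd ha h

lemma finrank_spanT (s : Finset (Option F)) (hs : s.card ≤ 4) :
    finrank F (span F (vv F '' (s : Set (Option F)))) = s.card := by
  have h := finrank_span_eq_card (vv_indep F s hs)
  rw [Set.image_eq_range]
  simpa using h

lemma vv_ne (a : Option F) : vv F a ≠ 0 := by
  obtain ⟨φ, h, -⟩ := sepT F a ∅ (by simp) (by simp)
  rintro h0
  exact h (by simp [h0])

lemma span_vv_inj : Function.Injective (fun a => span F {vv F a}) := by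
  intro a b hab
  by_contra hne
  obtain ⟨φ, h1, h2⟩ := sepT F a {b} (by simpa using hne) (by simp)
  have hm : vv F a ∈ span F {vv F b} := by
    rw [← show span F {vv F a} = span F {vv F b} from hab]
    exact mem_span_singleton_self _
  obtain ⟨c, hc⟩ := mem_span_singleton.1 hm
  apply h1
  rw [← hc, map_smul, h2 b (by simp), smul_zero]

open Classical in
lemma ptsOn_ncard [Fintype F] (W : Submodule F (Fin 4 → F)) :
    (ptsOn F W).ncard = (Finset.univ.filter (fun a => vv F a ∈ W)).card := by
  have : ptsOn F W = (fun a => span F {vv F a}) ''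
      ((Finset.univ.filter (fun a => vv F a ∈ W) : Finset (Option F)) : Set (Option F)) := by
    ext P
    simp only [ptsOn, cubicPts, Set.mem_setOf_eq, Set.mem_image, Finset.coe_filter,
      Finset.mem_univ, true_and]
    constructor
    · rintro ⟨⟨t, rfl⟩ | rfl, h⟩
      · refine ⟨some t, ?_, by simp [vv, hX, hY]⟩
        rw [span_singleton_le_iff_mem] at h
        simpa [vv, hX, hY] using h
      · refine ⟨none, ?_, by simp [vv, hX, hY]⟩
        rw [span_singleton_le_iff_mem] at h
        simpa [vv, hX, hY] using h
    · rintro ⟨a, h, rfl⟩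
      refine ⟨?_, by rwa [span_singleton_le_iff_mem]⟩
      cases a with
      | some t => exact Or.inl ⟨t, by simp [vv, hX, hY]⟩
      | none => exact Or.inr (by simp [vv, hX, hY])
  rw [this, Set.ncard_image_of_injective _ (span_vv_inj F), Set.ncard_coe_finset]

open Classical in
lemma ncard_le_three [Fintype F] (W : Submodule F (Fin 4 → F)) (hW : finrank F W = 3) :
    (ptsOn F W).ncard ≤ 3 := by
  rw [ptsOn_ncard]
  by_contra! h
  obtain ⟨s, hs, hc⟩ := Finset.exists_subset_card_eq (Nat.succ_le_of_lt h)
  have h1 := finrank_spanT F s (by omega)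
  have h2 : span F (vv F '' (s : Set (Option F))) ≤ W := by
    rw [span_le]
    rintro _ ⟨a, ha, rfl⟩
    exact (Finset.mem_filter.1 (hs ha)).2
  have := Submodule.finrank_mono h2
  omega

instance dualFin [Fintype F] : Finite (Dual F (Fin 4 → F)) := Module.finite_of_finite F

instance dualFintype [Fintype F] : Fintype (Dual F (Fin 4 → F)) := Fintype.ofFinite _

instance subFintype [Fintype F] : Fintype (Submodule F (Fin 4 → F)) := Fintype.ofFinite _

open Classical in
lemma card_ann [Fintype F] (U : Submodule F (Fin 4 → F)) :
    (Finset.univ.filter (fun φ : Dual F (Fin 4 → F) => U ≤ LinearMap.ker φ)).card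
      = Fintype.card F ^ (4 - finrank F U) := by
  have h1 := Subspace.finrank_add_finrank_dualAnnihilator_eq U
  have h2 : Nat.card U.dualAnnihilator = Fintype.card F ^ finrank F U.dualAnnihilator := by
    rw [Nat.card_eq_fintype_card, Module.card_eq_pow_finrank (K := F)]
  rw [finrank_fin_fun] at h1
  rw [show 4 - finrank F U = finrank F U.dualAnnihilator by omega, ← h2,
    ← Fintype.card_subtype, ← Nat.card_eq_fintype_card]
  apply Nat.card_congr
  apply Equiv.subtypeEquivRight
  intro φ
  rw [mem_dualAnnihilator]
  rfl

open Classical in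
lemma card_vanish [Fintype F] (s : Finset (Option F)) (hs : s.card ≤ 4) :
    (Finset.univ.filter (fun φ : Dual F (Fin 4 → F) => ∀ a ∈ s, φ (vv F a) = 0)).card
      = Fintype.card F ^ (4 - s.card) := by
  rw [← finrank_spanT F s hs, ← card_ann]
  congr 1
  ext φ
  simp [span_le, Set.subset_def]

lemma finrank_ker_three (φ : Dual F (Fin 4 → F)) (h : φ ≠ 0) :
    finrank F (LinearMap.ker φ) = 3 := by
  have h1 := LinearMap.finrank_range_add_finrank_ker φ
  rw [LinearMap.range_eq_top.2 (LinearMap.surjective h), finrank_fin_fun, finrank_top,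
    finrank_self] at h1
  omega

open Classical in
lemma card_fiber [Fintype F] (W : Submodule F (Fin 4 → F)) (hW : finrank F W = 3) :
    (Finset.univ.filter (fun φ : Dual F (Fin 4 → F) => φ ≠ 0 ∧ LinearMap.ker φ = W)).card
      = Fintype.card F - 1 := by
  have h := card_ann F W
  rw [hW, show 4 - 3 = 1 from rfl, pow_one] at h
  rw [← h, ← Finset.card_erase_of_mem (a := (0 : Dual F (Fin 4 → F))) (by simp)]
  congr 1
  ext φ
  simp only [Finset.mem_filter, Finset.mem_univ, true_and, Finset.mem_erase]
  constructor
  · rintro ⟨h1, rfl⟩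
    exact ⟨h1, le_rfl⟩
  · rintro ⟨h1, h2⟩
    exact ⟨h1, (Submodule.eq_of_le_of_finrank_eq h2
      (by rw [hW, finrank_ker_three F φ h1])).symm⟩

open Classical in
lemma sum_choose [Fintype F] (j : ℕ) (hj : j ≤ 4) :
    ∑ φ : Dual F (Fin 4 → F), ((ptsOn F (LinearMap.ker φ)).ncard).choose j
      = (Fintype.card F + 1).choose j * Fintype.card F ^ (4 - j) := by
  have h1 : ∀ φ : Dual F (Fin 4 → F), ((ptsOn F (LinearMap.ker φ)).ncard).choose j
      = ∑ s ∈ Finset.powersetCard j (Finset.univ : Finset (Option F)),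
        if ∀ a ∈ s, φ (vv F a) = 0 then 1 else 0 := by
    intro φ
    rw [ptsOn_ncard, ← Finset.card_powersetCard, ← Finset.card_filter]
    congr 1
    ext s
    simp only [Finset.mem_powersetCard, Finset.mem_filter, Finset.subset_iff, Finset.mem_univ,
      true_and, LinearMap.mem_ker]
    tauto
  rw [Finset.sum_congr rfl (fun φ _ => h1 φ), Finset.sum_comm]
  rw [Finset.sum_congr rfl (g := fun _ => Fintype.card F ^ (4 - j))]
  · rw [Finset.sum_const, Finset.card_powersetCard, Finset.card_univ, Fintype.card_option,
      smul_eq_mul]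
  · intro s hs
    have hc := (Finset.mem_powersetCard.1 hs).2
    rw [← Finset.card_filter, card_vanish F s (by omega), hc]

open Classical in
lemma sum_planes [Fintype F] (g : Submodule F (Fin 4 → F) → ℕ) :
    ∑ φ : Dual F (Fin 4 → F), g (LinearMap.ker φ)
      = g ⊤ + (Fintype.card F - 1) *
        ∑ W ∈ Finset.univ.filter (fun W : Submodule F (Fin 4 → F) => finrank F W = 3), g W := by
  rw [← Finset.add_sum_erase _ _ (Finset.mem_univ (0 : Dual F (Fin 4 → F))), LinearMap.ker_zero]
  congr 1
  rw [← Finset.sum_fiberwise_of_maps_to (g := fun φ : Dual F (Fin 4 → F) => LinearMap.ker φ)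
    (t := Finset.univ.filter (fun W : Submodule F (Fin 4 → F) => finrank F W = 3)),
    Finset.mul_sum]
  · apply Finset.sum_congr rfl
    intro W hW
    rw [← card_fiber F W (Finset.mem_filter.1 hW).2, ← smul_eq_mul, ← Finset.sum_const]
    apply Finset.sum_congr
    · ext φ
      simp
    · intro φ hφ
      rw [(Finset.mem_filter.1 hφ).2.2]
  · intro φ hφ
    simp only [Finset.mem_filter, Finset.mem_univ, true_and]
    exact finrank_ker_three F φ (Finset.ne_of_mem_erase hφ)

lemma main_count [Fintype F] (j : ℕ) (hj : j ≤ 4) :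
    (Fintype.card F + 1).choose j * Fintype.card F ^ (4 - j)
      = (Fintype.card F + 1).choose j + (Fintype.card F - 1) *
        ∑ k ∈ Finset.range 4,
          {W : Submodule F (Fin 4 → F) | finrank F W = 3 ∧ (ptsOn F W).ncard = k}.ncard
            * k.choose j := by
  classical
  rw [← sum_choose F j hj, sum_planes F (fun W => (ptsOn F W).ncard.choose j)]
  congr 1
  · rw [ptsOn_ncard]
    simp
  · congr 1
    rw [← Finset.sum_fiberwise_of_maps_to (g := fun W => (ptsOn F W).ncard)
      (t := Finset.range 4)]
    · apply Finset.sum_congr rfl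
      intro k _
      rw [Finset.filter_filter, Finset.sum_congr rfl (g := fun _ => k.choose j),
        Finset.sum_const, smul_eq_mul, ← Set.ncard_coe_finset]
      · simp
      · intro W hW
        rw [(Finset.mem_filter.1 hW).2.2]
    · intro W hW
      have := ncard_le_three F W (Finset.mem_filter.1 hW).2
      simp only [Finset.mem_range]
      omega

/-- Theorem (classification of planes): no plane of `P³(F_q)` contains more than three
points of `C₃(q)`, and the numbers of planes containing exactly 3, 2, 1, 0 points of
`C₃(q)` are `q(q²−1)/6`, `q(q+1)`, `(q+1) + q(q²−1)/2` and `q(q²−1)/3` respectively. -/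
theorem plane_classification [Fintype F] (q : ℕ) (hq : q = Fintype.card F) :
    (∀ W : Submodule F (Fin 4 → F), finrank F W = 3 → (ptsOn F W).ncard ≤ 3) ∧
    ({W : Submodule F (Fin 4 → F) | finrank F W = 3 ∧ (ptsOn F W).ncard = 3}.ncard : ℚ)
      = q * (q ^ 2 - 1) / 6 ∧
    ({W : Submodule F (Fin 4 → F) | finrank F W = 3 ∧ (ptsOn F W).ncard = 2}.ncard : ℚ)
      = q * (q + 1) ∧
    ({W : Submodule F (Fin 4 → F) | finrank F W = 3 ∧ (ptsOn F W).ncard = 1}.ncard : ℚ)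
      = (q + 1) + q * (q ^ 2 - 1) / 2 ∧
    ({W : Submodule F (Fin 4 → F) | finrank F W = 3 ∧ (ptsOn F W).ncard = 0}.ncard : ℚ)
      = q * (q ^ 2 - 1) / 3 := by
  refine ⟨fun W hW => ncard_le_three F W hW, ?_⟩
  have h0 := main_count F 0 (by omega)
  have h1 := main_count F 1 (by omega)
  have h2 := main_count F 2 (by omega)
  have h3 := main_count F 3 (by omega)
  have hq2 : 1 < q := hq ▸ Fintype.one_lt_card
  rw [← hq] at h0 h1 h2 h3
  simp only [Finset.sum_range_succ, Finset.sum_range_zero] at h0 h1 h2 h3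
  generalize Set.ncard {W : Submodule F (Fin 4 → F) | finrank F W = 3 ∧ (ptsOn F W).ncard = 0} = n0 at *
  generalize Set.ncard {W : Submodule F (Fin 4 → F) | finrank F W = 3 ∧ (ptsOn F W).ncard = 1} = n1 at *
  generalize Set.ncard {W : Submodule F (Fin 4 → F) | finrank F W = 3 ∧ (ptsOn F W).ncard = 2} = n2 at *
  generalize Set.ncard {W : Submodule F (Fin 4 → F) | finrank F W = 3 ∧ (ptsOn F W).ncard = 3} = n3 at *
  clear hq
  have c1 : (Nat.choose 3 2) = 3 := rfl
  have c2 : (Nat.choose 2 3) = 0 := rfl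
  have c3 : (Nat.choose 1 2) = 0 := rfl
  have c4 : (Nat.choose 1 3) = 0 := rfl
  have c5 : (Nat.choose 0 3) = 0 := rfl
  have c6 : (Nat.choose 0 2) = 0 := rfl
  have c7 : (Nat.choose 0 1) = 0 := rfl
  obtain ⟨m, rfl⟩ : ∃ m, q = m + 1 := ⟨q - 1, by omega⟩
  have hm : (m : ℚ) ≠ 0 := by
    have : m ≠ 0 := by omega
    exact_mod_cast this
  have e2 : ((m + 1 + 1).choose 2 : ℚ) = (m + 2) * (m + 1) / 2 := by
    rw [Nat.cast_choose_two]; push_cast; ring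
  have e3 : ((m + 1 + 1).choose 3 : ℚ) = (m + 2) * (m + 1) * m / 6 := by
    have h := Nat.add_one_mul_choose_eq (m + 1) 2
    have h' : ((m + 1 + 1 : ℕ) : ℚ) * ((m + 1).choose 2 : ℚ) = ((m + 1 + 1).choose 3 : ℚ) * 3 := by
      exact_mod_cast h
    rw [Nat.cast_choose_two] at h'
    push_cast at h'
    linarith
  simp only [c1, c2, c3, c4, c5, c6, c7, Nat.choose_zero_right, Nat.choose_one_right,
    Nat.choose_self, Nat.add_sub_cancel] at h0 h1 h2 h3
  have g0 := congrArg (Nat.cast : ℕ → ℚ) h0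
  have g1 := congrArg (Nat.cast : ℕ → ℚ) h1
  have g2 := congrArg (Nat.cast : ℕ → ℚ) h2
  have g3 := congrArg (Nat.cast : ℕ → ℚ) h3
  push_cast at g0 g1 g2 g3 ⊢
  rw [e2] at g2
  rw [e3] at g3
  norm_num at g0 g1 g2 g3
  have k3 : (n3 : ℚ) = (m + 2) * (m + 1) * m / 6 := by
    apply mul_left_cancel₀ hm
    linear_combination -g3
  have k2 : (n2 : ℚ) = (m + 2) * (m + 1) / 2 * (m + 2) - 3 * n3 := by
    apply mul_left_cancel₀ hm
    linear_combination -g2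
  have k1 : (n1 : ℚ) = (m + 2) * ((m + 1) ^ 2 + (m + 1) + 1) - 2 * n2 - 3 * n3 := by
    apply mul_left_cancel₀ hm
    linear_combination -g1
  have k0 : (n0 : ℚ) = (m + 1) ^ 3 + (m + 1) ^ 2 + (m + 1) + 1 - n1 - n2 - n3 := by
    apply mul_left_cancel₀ hm
    linear_combination -g0
  refine ⟨?_, ?_, ?_, ?_⟩
  · rw [k3]; ring
  · rw [k2, k3]; ring
  · rw [k1, k2, k3]; ring
  · rw [k0, k1, k2, k3]; ring

end
end

section
/- Let q > 3 be a prime power. Every point of P^3(F_q) either lies on C_3(q), or lies on a real chord of C_3, or lies in some 3-plane. -/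
open Submodule Module

noncomputable section

variable (F : Type) [Field F]

/-- The linear form with coefficients `a b c d`. -/
def planeForm (a b c d : F) : (Fin 4 → F) →ₗ[F] F :=
  a • (LinearMap.proj 0 : (Fin 4 → F) →ₗ[F] F) + b • (LinearMap.proj 1 : (Fin 4 → F) →ₗ[F] F)
    + c • (LinearMap.proj 2 : (Fin 4 → F) →ₗ[F] F) + d • (LinearMap.proj 3 : (Fin 4 → F) →ₗ[F] F)

lemma planeForm_apply (a b c d : F) (v : Fin 4 → F) :
    planeForm F a b c d v = a * v 0 + b * v 1 + c * v 2 + d * v 3 := by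
  simp [planeForm]

lemma finrank_ker_form (f : (Fin 4 → F) →ₗ[F] F) (hf : f ≠ 0) :
    finrank F (LinearMap.ker f) = 3 := by
  have h1 := LinearMap.finrank_range_add_finrank_ker f
  have h2 : LinearMap.range f = ⊤ := LinearMap.range_eq_top.2 (LinearMap.surjective hf)
  rw [h2, finrank_top, finrank_self, finrank_fin_fun] at h1
  omega

lemma span_pt_inj {s t : F}
    (h : span F {![s ^ 3, s ^ 2, s, 1]} = span F {![t ^ 3, t ^ 2, t, 1]}) : s = t := by
  have h1 : ![s ^ 3, s ^ 2, s, 1] ∈ span F {![t ^ 3, t ^ 2, t, 1]} := by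
    rw [← h]; exact mem_span_singleton_self _
  obtain ⟨c, hc⟩ := mem_span_singleton.1 h1
  have h2 := congrFun hc 2
  have h3 := congrFun hc 3
  simp at h2 h3
  subst h3
  simpa using h2.symm

lemma span_pt_ne_inf {s : F}
    (h : span F {![s ^ 3, s ^ 2, s, 1]} = span F {![(1 : F), 0, 0, 0]}) : False := by
  have h1 : ![s ^ 3, s ^ 2, s, 1] ∈ span F {![(1 : F), 0, 0, 0]} := by
    rw [← h]; exact mem_span_singleton_self _
  obtain ⟨c, hc⟩ := mem_span_singleton.1 h1
  have h3 := congrFun hc 3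
  simp at h3

lemma threePlane_fin {x y z : F} (hxy : x ≠ y) (hxz : x ≠ z) (hyz : y ≠ z) :
    IsThreePlane F (LinearMap.ker (planeForm F 1 (-(x + y + z)) (x * y + x * z + y * z)
      (-(x * y * z)))) := by
  refine ⟨finrank_ker_form F _ ?_, ?_⟩
  · intro h
    have := LinearMap.congr_fun h ![1, 0, 0, 0]
    simp [planeForm_apply] at this
  · rw [Set.ncard_eq_three]
    refine ⟨span F {![x ^ 3, x ^ 2, x, 1]}, span F {![y ^ 3, y ^ 2, y, 1]},
      span F {![z ^ 3, z ^ 2, z, 1]}, fun h => hxy (span_pt_inj F h),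
      fun h => hxz (span_pt_inj F h), fun h => hyz (span_pt_inj F h), ?_⟩
    ext Q
    simp only [ptsOn, cubicPts, Set.mem_ofPred_eq, Set.mem_insert_iff, Set.mem_singleton_iff]
    constructor
    · rintro ⟨⟨t, rfl⟩ | rfl, h⟩
      · rw [span_singleton_le_iff_mem, LinearMap.mem_ker, planeForm_apply] at h
        simp at h
        have : (t - x) * ((t - y) * (t - z)) = 0 := by linear_combination h
        rcases mul_eq_zero.1 this with h | h
        · left; rw [sub_eq_zero.1 h]
        rcases mul_eq_zero.1 h with h | h
        · right; left; rw [sub_eq_zero.1 h]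
        · right; right; rw [sub_eq_zero.1 h]
      · rw [span_singleton_le_iff_mem, LinearMap.mem_ker, planeForm_apply] at h
        simp at h
    · rintro (rfl | rfl | rfl)
      all_goals
        refine ⟨Or.inl ⟨_, rfl⟩, ?_⟩
        rw [span_singleton_le_iff_mem, LinearMap.mem_ker, planeForm_apply]
        simp
        ring

lemma threePlane_inf {x y : F} (hxy : x ≠ y) :
    IsThreePlane F (LinearMap.ker (planeForm F 0 1 (-(x + y)) (x * y))) := by
  refine ⟨finrank_ker_form F _ ?_, ?_⟩
  · intro h
    have := LinearMap.congr_fun h ![0, 1, 0, 0]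
    simp [planeForm_apply] at this
  · rw [Set.ncard_eq_three]
    refine ⟨span F {![x ^ 3, x ^ 2, x, 1]}, span F {![y ^ 3, y ^ 2, y, 1]},
      span F {![1, 0, 0, 0]}, fun h => hxy (span_pt_inj F h),
      fun h => span_pt_ne_inf F h, fun h => span_pt_ne_inf F h, ?_⟩
    ext Q
    simp only [ptsOn, cubicPts, Set.mem_ofPred_eq, Set.mem_insert_iff, Set.mem_singleton_iff]
    constructor
    · rintro ⟨⟨t, rfl⟩ | rfl, h⟩
      · rw [span_singleton_le_iff_mem, LinearMap.mem_ker, planeForm_apply] at h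
        simp at h
        have : (t - x) * (t - y) = 0 := by linear_combination h
        rcases mul_eq_zero.1 this with h | h
        · left; rw [sub_eq_zero.1 h]
        · right; left; rw [sub_eq_zero.1 h]
      · right; right; rfl
    · rintro (rfl | rfl | rfl)
      · refine ⟨Or.inl ⟨_, rfl⟩, ?_⟩
        rw [span_singleton_le_iff_mem, LinearMap.mem_ker, planeForm_apply]
        simp
        ring
      · refine ⟨Or.inl ⟨_, rfl⟩, ?_⟩
        rw [span_singleton_le_iff_mem, LinearMap.mem_ker, planeForm_apply]
        simp
        ring
      · refine ⟨Or.inr rfl, ?_⟩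
        rw [span_singleton_le_iff_mem, LinearMap.mem_ker, planeForm_apply]
        simp

open Classical in
lemma card_quad [Fintype F] (a b c : F) (h : ¬ (a = 0 ∧ b = 0 ∧ c = 0)) :
    (Finset.univ.filter fun x : F => a + b * x + c * x ^ 2 = 0).card ≤ 2 := by
  by_contra hc
  push Not at hc
  obtain ⟨x, y, z, hx, hy, hz, hxy, hxz, hyz⟩ := Finset.two_lt_card_iff.1 hc
  simp only [Finset.mem_filter, Finset.mem_univ, true_and] at hx hy hz
  have e1 : b + c * (x + y) = 0 := by
    apply mul_left_cancel₀ (sub_ne_zero.2 hxy); linear_combination hx - hy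
  have e2 : b + c * (x + z) = 0 := by
    apply mul_left_cancel₀ (sub_ne_zero.2 hxz); linear_combination hx - hz
  have e3 : c = 0 := by
    apply mul_left_cancel₀ (sub_ne_zero.2 hyz); linear_combination e1 - e2
  subst e3
  have e4 : b = 0 := by simpa using e1
  subst e4
  exact h ⟨by simpa using hx, rfl, rfl⟩

open Classical in
lemma card_quad_two [Fintype F] (h2 : (2 : F) = 0) (a c : F) (h : ¬ (a = 0 ∧ c = 0)) :
    (Finset.univ.filter fun x : F => a + c * x ^ 2 = 0).card ≤ 1 := by
  rw [Finset.card_le_one]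
  intro x hx y hy
  simp only [Finset.mem_filter, Finset.mem_univ, true_and] at hx hy
  by_contra hxy
  have e3 : c = 0 := by
    have : (x - y) ^ 2 ≠ 0 := pow_ne_zero _ (sub_ne_zero.2 hxy)
    apply mul_left_cancel₀ this
    linear_combination hx - hy + c * (y ^ 2 - x * y) * h2
  subst e3
  exact h ⟨by simpa using hx, rfl⟩

open Classical in
lemma card_lin [Fintype F] (a b : F) (h : ¬ (a = 0 ∧ b = 0)) :
    (Finset.univ.filter fun x : F => a + b * x = 0).card ≤ 1 := by
  rw [Finset.card_le_one]
  intro x hx y hy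
  simp only [Finset.mem_filter, Finset.mem_univ, true_and] at hx hy
  by_contra hxy
  have e3 : b = 0 := by
    apply mul_left_cancel₀ (sub_ne_zero.2 hxy)
    linear_combination hx - hy
  subst e3
  exact h ⟨by simpa using hx, rfl⟩

open Classical in
lemma exists_beta [Fintype F] (hq : 3 < Fintype.card F) (x A B C : F)
    (h1 : B ^ 2 ≠ A * C) (h2 : ¬ (A = 0 ∧ C = 0)) :
    ∃ y : F, y ≠ x ∧ A - 2 * B * y + C * y ^ 2 ≠ 0 ∧ (A - B * x) - (B - C * x) * y ≠ 0 := by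
  by_contra hcon
  push Not at hcon
  set S1 := Finset.univ.filter fun y : F => A + (-(2 * B)) * y + C * y ^ 2 = 0 with hS1
  set S2 := Finset.univ.filter fun y : F => (A - B * x) + (-(B - C * x)) * y = 0 with hS2
  have hsub : (Finset.univ : Finset F) ⊆ {x} ∪ (S1 ∪ S2) := by
    intro y _
    simp only [hS1, hS2, Finset.mem_union, Finset.mem_singleton, Finset.mem_filter,
      Finset.mem_univ, true_and]
    by_cases a1 : y = x
    · exact Or.inl a1
    by_cases a2 : A - 2 * B * y + C * y ^ 2 = 0
    · right; left; linear_combination a2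
    · right; right; linear_combination hcon y a1 a2
  have c0 := Finset.card_le_card hsub
  have c1 := Finset.card_union_le {x} (S1 ∪ S2)
  have c2 := Finset.card_union_le S1 S2
  have c3 : S2.card ≤ 1 := by
    apply card_lin
    rintro ⟨e1, e2⟩
    apply h1
    linear_combination (-B) * e2 - C * e1
  rw [Finset.card_univ] at c0
  rw [Finset.card_singleton] at c1
  have c4 : S1.card ≤ 2 := by
    apply card_quad
    rintro ⟨e1, _, e2⟩
    exact h2 ⟨e1, e2⟩
  have c5 : Fintype.card F = 4 := by omega
  have c6 : (2 : F) = 0 := by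
    have : ((Fintype.card F : ℕ) : F) = 0 := Nat.cast_card_eq_zero F
    rw [c5] at this
    have h4 : (2 : F) * 2 = 0 := by
      push_cast at this
      linear_combination this
    simpa using h4
  have c7 : S1.card ≤ 1 := by
    have := card_quad_two F c6 A C h2
    have e : S1 = Finset.univ.filter fun y : F => A + C * y ^ 2 = 0 := by
      rw [hS1, c6]; simp
    rw [e]; exact this
  omega

open Classical in
lemma exists_alpha [Fintype F] (hq : 3 < Fintype.card F) (a b c d : F)
    (h0 : ¬ (a = 0 ∧ b = 0 ∧ c = 0 ∧ d = 0))
    (h1 : ¬ (b ^ 2 - a * c = 0 ∧ a * d - b * c = 0 ∧ c ^ 2 - b * d = 0)) :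
    ∃ x : F, (b - c * x) ^ 2 ≠ (a - b * x) * (c - d * x) ∧
      ¬ (a - b * x = 0 ∧ c - d * x = 0) := by
  by_contra hcon
  push Not at hcon
  set S1 := Finset.univ.filter
    fun y : F => (b ^ 2 - a * c) + (a * d - b * c) * y + (c ^ 2 - b * d) * y ^ 2 = 0 with hS1
  set S2 := Finset.univ.filter fun y : F => a - b * y = 0 ∧ c - d * y = 0 with hS2
  have hsub : (Finset.univ : Finset F) ⊆ S1 ∪ S2 := by
    intro y _
    simp only [hS1, hS2, Finset.mem_union, Finset.mem_filter, Finset.mem_univ, true_and]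
    by_cases a2 : (b - c * y) ^ 2 = (a - b * y) * (c - d * y)
    · left; linear_combination a2
    · right; exact hcon y a2
  have c0 := Finset.card_le_card hsub
  have c2 := Finset.card_union_le S1 S2
  have c3 : S2.card ≤ 1 := by
    rw [Finset.card_le_one]
    intro x hx y hy
    simp only [hS2, Finset.mem_filter, Finset.mem_univ, true_and] at hx hy
    by_contra hxy
    have e1 : b = 0 := by
      apply mul_left_cancel₀ (sub_ne_zero.2 hxy); linear_combination hy.1 - hx.1
    have e2 : d = 0 := by
      apply mul_left_cancel₀ (sub_ne_zero.2 hxy); linear_combination hy.2 - hx.2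
    subst e1 e2
    exact h0 ⟨by simpa using hx.1, rfl, by simpa using hx.2, rfl⟩
  have c4 : S1.card ≤ 2 := card_quad F _ _ _ h1
  rw [Finset.card_univ] at c0
  omega

/-- Theorem: for `q > 3`, every point of `P³(F_q)` lies on `C₃(q)`, or on a real chord
of `C₃`, or in some 3-plane. -/
theorem point_on_cubic_or_chord_or_three_plane [Fintype F] (hq : 3 < Fintype.card F)
    (P : Submodule F (Fin 4 → F)) (hP : finrank F P = 1) :
    P ∈ cubicPts F ∨ (∃ L, IsRealChord F L ∧ P ≤ L) ∨ (∃ W, IsThreePlane F W ∧ P ≤ W) := by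
  obtain ⟨v, hv0, hv⟩ := finrank_eq_one_iff'.1 hP
  have hPv : P = span F {(v : Fin 4 → F)} := by
    apply le_antisymm
    · intro w hw
      obtain ⟨c, hc⟩ := hv ⟨w, hw⟩
      exact mem_span_singleton.2 ⟨c, congrArg Subtype.val hc⟩
    · rw [span_singleton_le_iff_mem]; exact v.2
  have hw0 : (v : Fin 4 → F) ≠ 0 := fun h => hv0 (Subtype.ext h)
  generalize (v : Fin 4 → F) = w at hPv hw0
  subst hPv
  have h0 : ¬ (w 0 = 0 ∧ w 1 = 0 ∧ w 2 = 0 ∧ w 3 = 0) := by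
    rintro ⟨a, b, c, d⟩
    apply hw0
    ext i
    fin_cases i <;> simpa
  by_cases h1 : w 1 ^ 2 - w 0 * w 2 = 0 ∧ w 0 * w 3 - w 1 * w 2 = 0 ∧ w 2 ^ 2 - w 1 * w 3 = 0
  · left
    obtain ⟨e1, e2, e3⟩ := h1
    by_cases h3 : w 3 = 0
    · right
      have h2 : w 2 = 0 := by simpa [h3] using e3
      have h1 : w 1 = 0 := by simpa [h2] using e1
      have h00 : w 0 ≠ 0 := fun h => h0 ⟨h, h1, h2, h3⟩
      have : w = w 0 • ![1, 0, 0, 0] := by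
        ext i
        fin_cases i <;> simp [h1, h2, h3]
      rw [this]
      exact span_singleton_smul_eq (IsUnit.mk0 _ h00) _
    · left
      refine ⟨w 2 / w 3, ?_⟩
      have e1' : w 1 = w 3 * (w 2 / w 3) ^ 2 := by
        field_simp; linear_combination -e3
      have e0' : w 0 = w 3 * (w 2 / w 3) ^ 3 := by
        field_simp; linear_combination w 3 * e2 - w 2 * e3
      have e2' : w 2 = w 3 * (w 2 / w 3) := by
        field_simp
      have : w = w 3 • ![(w 2 / w 3) ^ 3, (w 2 / w 3) ^ 2, w 2 / w 3, 1] := by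
        ext i
        fin_cases i
        · exact e0'
        · exact e1'
        · exact e2'
        · simp
      conv_lhs => rw [this]
      exact span_singleton_smul_eq (IsUnit.mk0 _ h3) _
  · right; right
    obtain ⟨x, hx1, hx2⟩ := exists_alpha F hq _ _ _ _ h0 h1
    obtain ⟨y, hy1, hy2, hy3⟩ := exists_beta F hq x _ _ _ hx1 hx2
    by_cases hB : (w 1 - w 2 * x) - (w 2 - w 3 * x) * y = 0
    · refine ⟨_, threePlane_inf F hy1, ?_⟩
      rw [span_singleton_le_iff_mem, LinearMap.mem_ker, planeForm_apply]
      linear_combination hB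
    · obtain ⟨z, hz⟩ : ∃ z, z * ((w 1 - w 2 * x) - (w 2 - w 3 * x) * y) =
          (w 0 - w 1 * x) - (w 1 - w 2 * x) * y := ⟨_, div_mul_cancel₀ _ hB⟩
      have hyz : y ≠ z := by
        rintro rfl
        apply hy2
        linear_combination -hz
      have hxz : x ≠ z := by
        rintro rfl
        apply hy3
        linear_combination -hz
      refine ⟨_, threePlane_fin F hy1.symm hxz hyz, ?_⟩
      rw [span_singleton_le_iff_mem, LinearMap.mem_ker, planeForm_apply]
      linear_combination -hz

end
end

section
/- For every prime power q, every plane of P^3(F_q) that contains an imaginary chord of C_3 contains exactly one point of C_3(q); in particular no imaginary chord is contained in a 3-plane. -/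
open Submodule Module

noncomputable section

variable (F : Type) [Field F]

/-- Theorem: every plane of `P³(F_q)` containing an imaginary chord of `C₃` contains
exactly one point of `C₃(q)`; in particular no imaginary chord lies in a 3-plane.
Here `E` is the quadratic extension `F_{q²}` of `F = F_q`. -/
theorem imag_chord_plane_one_point [Fintype F] (E : Type) [Field E] [Algebra F E]
    (hE : finrank F E = 2)
    (W : Submodule F (Fin 4 → F)) (hW : finrank F W = 3)
    (L : Submodule F (Fin 4 → F)) (hL : IsImagChord F E L) (hLW : L ≤ W) :
    (ptsOn F W).ncard = 1 ∧ ¬ IsThreePlane F W := by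
  obtain ⟨hL2, ξ, hξ, hmem⟩ := hL
  -- a linear form defining the plane
  have hlt : W < ⊤ := by
    rw [lt_top_iff_ne_top]
    rintro rfl
    rw [finrank_top] at hW
    simp at hW
  obtain ⟨f, hf0, hfW⟩ := Submodule.exists_le_ker_of_lt_top W hlt
  have hker : W = LinearMap.ker f := by
    apply Submodule.eq_of_le_of_finrank_le hfW
    have h1 : LinearMap.ker f < ⊤ := by
      rw [lt_top_iff_ne_top]
      intro h
      exact hf0 (LinearMap.ker_eq_top.mp h)
    have h2 := Submodule.finrank_lt h1.ne
    simp at h2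
    omega
  have hfe : ∀ v, f v = v 0 * f (Pi.single 0 1) + v 1 * f (Pi.single 1 1)
      + v 2 * f (Pi.single 2 1) + v 3 * f (Pi.single 3 1) := by
    intro v
    rw [LinearMap.pi_apply_eq_sum_univ f v]
    simp only [Fin.sum_univ_four, smul_eq_mul]
    congr <;> (funext i; simp [Pi.single_apply, eq_comm])
  obtain ⟨a, ha⟩ : ∃ a, a = f (Pi.single 0 1) := ⟨_, rfl⟩
  obtain ⟨b, hb⟩ : ∃ b, b = f (Pi.single 1 1) := ⟨_, rfl⟩
  obtain ⟨c, hc⟩ : ∃ c, c = f (Pi.single 2 1) := ⟨_, rfl⟩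
  obtain ⟨d, hd⟩ : ∃ d, d = f (Pi.single 3 1) := ⟨_, rfl⟩
  rw [← ha, ← hb, ← hc, ← hd] at hfe
  -- the form vanishes at the imaginary point
  have hvan : ∀ v ∈ span E (extVec F E '' (L : Set (Fin 4 → F))),
      v 0 * algebraMap F E a + v 1 * algebraMap F E b + v 2 * algebraMap F E c
        + v 3 * algebraMap F E d = 0 := by
    intro v hv
    induction hv using Submodule.span_induction with
    | mem x hx =>
      obtain ⟨w, hw, rfl⟩ := hx
      have h1 : f w = 0 := by simpa using hfW (hLW hw)
      rw [hfe] at h1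
      have h2 := congrArg (algebraMap F E) h1
      simpa [extVec] using h2
    | zero => simp
    | add x y _ _ hx hy =>
      simp only [Pi.add_apply]
      linear_combination hx + hy
    | smul e x _ hx =>
      simp only [Pi.smul_apply, smul_eq_mul]
      linear_combination e * hx
  have hξ0 := hvan _ hmem
  simp at hξ0
  -- independence and quadratic relation
  have hind : ∀ x y : F, algebraMap F E x * ξ + algebraMap F E y = 0 → x = 0 ∧ y = 0 := by
    intro x y h
    have hx : x = 0 := by
      by_contra hx
      apply hξ
      refine ⟨-y / x, ?_⟩
      have hx' : algebraMap F E x ≠ 0 := by simpa using hx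
      rw [map_div₀, map_neg, div_eq_iff hx']
      linear_combination -h
    subst hx
    simpa using h
  have hquad : ∃ s n : F, ξ ^ 2 = algebraMap F E s * ξ + algebraMap F E n := by
    have hli : LinearIndependent F ![ξ, 1] := by
      rw [LinearIndependent.pair_iff]
      intro x y h
      apply hind
      simpa [Algebra.smul_def] using h
    have hsp := hli.span_eq_top_of_card_eq_finrank (by simp [hE])
    have h1 : ξ ^ 2 ∈ span F (Set.range ![ξ, 1]) := by rw [hsp]; trivial
    simp only [Matrix.range_cons, Matrix.range_empty, Set.union_empty,
      Set.singleton_union] at h1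
    obtain ⟨s, n, h⟩ := Submodule.mem_span_pair.mp h1
    exact ⟨s, n, by simpa [Algebra.smul_def] using h.symm⟩
  obtain ⟨s, n, hq⟩ := hquad
  obtain ⟨e1, e2⟩ := hind (a * (s ^ 2 + n) + b * s + c) (a * s * n + b * n + d) (by
    simp only [map_add, map_mul, map_pow]
    linear_combination hξ0 - (algebraMap F E a * (ξ + algebraMap F E s) + algebraMap F E b) * hq)
  have hirr : ∀ t : F, t ^ 2 - s * t - n ≠ 0 := by
    intro t ht
    have ht' := congrArg (algebraMap F E) ht
    simp only [map_sub, map_mul, map_pow, map_zero] at ht'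
    have : (ξ - algebraMap F E t) * (ξ - algebraMap F E (s - t)) = 0 := by
      simp only [map_sub]
      linear_combination hq - ht'
    rcases mul_eq_zero.mp this with h | h
    · exact hξ ⟨t, (sub_eq_zero.mp h).symm⟩
    · exact hξ ⟨s - t, (sub_eq_zero.mp h).symm⟩
  have hpt : ∀ t : F, span F {![t ^ 3, t ^ 2, t, 1]} ≤ W ↔ a * t + (a * s + b) = 0 := by
    intro t
    rw [Submodule.span_singleton_le_iff_mem, hker, LinearMap.mem_ker, hfe]
    simp
    have : t ^ 3 * a + t ^ 2 * b + t * c + d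
        = (t ^ 2 - s * t - n) * (a * t + (a * s + b)) := by
      linear_combination t * e1 + e2
    rw [this, mul_eq_zero]
    simp [hirr t]
  have hinf : span F {![(1 : F), 0, 0, 0]} ≤ W ↔ a = 0 := by
    rw [Submodule.span_singleton_le_iff_mem, hker, LinearMap.mem_ker, hfe]
    simp
  have hone : (ptsOn F W).ncard = 1 := by
    rw [Set.ncard_eq_one]
    by_cases ha0 : a = 0
    · refine ⟨span F {![(1 : F), 0, 0, 0]}, ?_⟩
      ext P
      simp only [ptsOn, cubicPts, Set.mem_setOf_eq, Set.mem_singleton_iff]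
      constructor
      · rintro ⟨⟨t, rfl⟩ | rfl, h⟩
        · exfalso
          rw [hpt] at h
          have hb0 : b = 0 := by simpa [ha0] using h
          have hc0 : c = 0 := by simpa [ha0, hb0] using e1
          have hd0 : d = 0 := by simpa [ha0, hb0] using e2
          apply hf0
          ext1 i
          ext
          simp [hfe, ha0, hb0, hc0, hd0]
        · rfl
      · rintro rfl
        exact ⟨Or.inr rfl, hinf.mpr ha0⟩
    · obtain ⟨u, hu⟩ : ∃ u, u = -(a * s + b) / a := ⟨_, rfl⟩
      have hu' : a * u + (a * s + b) = 0 := by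
        rw [hu]; field_simp; ring
      refine ⟨span F {![u ^ 3, u ^ 2, u, 1]}, ?_⟩
      ext P
      simp only [ptsOn, cubicPts, Set.mem_setOf_eq, Set.mem_singleton_iff]
      constructor
      · rintro ⟨⟨t, rfl⟩ | rfl, h⟩
        · rw [hpt] at h
          have : t = u := mul_left_cancel₀ ha0 (by linear_combination h - hu')
          rw [this]
        · exact absurd (hinf.mp h) ha0
      · rintro rfl
        exact ⟨Or.inl ⟨u, rfl⟩, (hpt u).mpr hu'⟩
  refine ⟨hone, ?_⟩
  rintro ⟨_, h3⟩
  omega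

end
end

section
/- Let q ≥ 23 be a power of a prime p with p ≠ 3. If q ≡ 1 (mod 3), then every real axis of C_3 is contained in at least one 3-plane; if q ≡ 2 (mod 3), then no real axis of C_3 is contained in any 3-plane. -/
open Submodule Module

noncomputable section

variable (F : Type) [Field F]

/-- The bilinear bracket of two points of the projective line. -/
def brk : Option F → Option F → F
  | some b, some s => s - b
  | some _, none => 1
  | none, some _ => 1
  | none, none => 0

/-- A vector spanning the point of the cubic with a given parameter. -/
def cvec : Option F → (Fin 4 → F)
  | some t => ![t ^ 3, t ^ 2, t, 1]
  | none => ![1, 0, 0, 0]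

/-- The osculating form with a given parameter. -/
def ofm : Option F → ((Fin 4 → F) →ₗ[F] F)
  | some t => oscForm F t
  | none => (LinearMap.proj 3 : (Fin 4 → F) →ₗ[F] F)

lemma oscPlane_eq (a : Option F) : oscPlane F a = LinearMap.ker (ofm F a) := by
  cases a <;> rfl

lemma ofm_cvec (a s : Option F) : ofm F a (cvec F s) = brk F a s ^ 3 := by
  cases a <;> cases s <;> simp [ofm, cvec, brk, oscForm] <;> ring

lemma span_cvec_inj : Function.Injective (fun s : Option F => span F {cvec F s}) := by
  intro s s' h
  have h1 : cvec F s ∈ span F {cvec F s'} := by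
    have : span F {cvec F s} = span F {cvec F s'} := h
    rw [← this]; exact mem_span_singleton_self _
  obtain ⟨c, hc⟩ := mem_span_singleton.1 h1
  have e0 := congrFun hc 0
  have e2 := congrFun hc 2
  have e3 := congrFun hc 3
  cases s <;> cases s' <;> simp [cvec] at e0 e2 e3 ⊢
  · rw [e3] at e0; simp at e0
  · subst e3; simpa using e2.symm

lemma ptsOn_ker (φ : (Fin 4 → F) →ₗ[F] F) :
    ptsOn F (LinearMap.ker φ) = (fun s : Option F => span F {cvec F s}) '' {s | φ (cvec F s) = 0} := by
  ext P
  constructor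
  · rintro ⟨⟨t, rfl⟩ | rfl, h⟩
    · exact ⟨some t, h (mem_span_singleton_self _), rfl⟩
    · exact ⟨none, h (mem_span_singleton_self _), rfl⟩
  · rintro ⟨s, hs, rfl⟩
    refine ⟨?_, ?_⟩
    · cases s
      · exact Or.inr rfl
      · exact Or.inl ⟨_, rfl⟩
    · simpa [span_le] using hs

lemma cube_inj [Fintype F] (h : Fintype.card F % 3 = 2) :
    Function.Injective (fun x : F => x ^ 3) := by
  have key : ∀ x : F, (x ^ 3) ^ (2 * (Fintype.card F / 3) + 1) = x := by
    intro x
    have hx := FiniteField.pow_card x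
    obtain ⟨k, hk⟩ : ∃ k, Fintype.card F = 3 * k + 2 := ⟨Fintype.card F / 3, by omega⟩
    have hd : Fintype.card F / 3 = k := by omega
    rw [hd]
    rw [hk] at hx
    calc (x ^ 3) ^ (2 * k + 1) = x ^ (3 * k + 2) * x ^ (3 * k + 1) := by ring
      _ = x ^ (3 * k + 2) := by rw [hx, ← pow_succ']; exact hx
      _ = x := hx
  intro x y hxy
  have hxy' : x ^ 3 = y ^ 3 := hxy
  rw [← key x, ← key y, hxy']

lemma exists_omega [Fintype F] (h : Fintype.card F % 3 = 1) :
    ∃ w : F, w ^ 3 = 1 ∧ w ≠ 1 := by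
  classical
  have : Fact (Nat.Prime 3) := ⟨Nat.prime_three⟩
  have hd : 3 ∣ Fintype.card Fˣ := by rw [Fintype.card_units]; omega
  obtain ⟨x, hx⟩ := exists_prime_orderOf_dvd_card 3 hd
  refine ⟨x, ?_, ?_⟩
  · have := pow_orderOf_eq_one x
    rw [hx] at this
    rw [← Units.val_pow_eq_pow_val, this, Units.val_one]
  · intro h1
    have : x = 1 := Units.ext h1
    simp [this] at hx

lemma sol_card (h3 : (3 : F) ≠ 0) (w : F) (hw : w ^ 3 = 1) (hw1 : w ≠ 1)
    (a : F) (b : Option F) (hab : some a ≠ b) :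
    {s | brk F (some a) s ^ 3 - brk F b s ^ 3 = 0}.ncard = 3 := by
  have hw2 : w ^ 2 + w + 1 = 0 := by
    have : (w - 1) * (w ^ 2 + w + 1) = 0 := by linear_combination hw
    exact (mul_eq_zero.1 this).resolve_left (sub_ne_zero.2 hw1)
  have hww : w ^ 2 ≠ 1 := by
    intro h
    have : w = 1 := by linear_combination hw - w * h
    exact hw1 this
  have hne : w ≠ w ^ 2 := by
    intro h
    have h0 : w ≠ 0 := by rintro rfl; simp at hw
    exact hw1 (mul_left_cancel₀ h0 (by linear_combination -h))
  have fac : ∀ x y : F, x ^ 3 - y ^ 3 = (x - y) * (x - w * y) * (x - w ^ 2 * y) := by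
    intro x y
    linear_combination (x^2*y - w * x * y^2 ) * hw2 + (y^3) * hw
  rw [Set.ncard_eq_three]
  cases b with
  | none =>
    refine ⟨some (a + 1), some (a + w), some (a + w ^ 2), ?_, ?_, ?_, ?_⟩
    · simpa using hw1.symm
    · simpa using hww.symm
    · simpa using hne
    · ext s
      cases s with
      | none => simp [brk]
      | some s =>
        simp only [Set.mem_ofPred_eq, fac, brk, mul_eq_zero, Set.mem_insert_iff,
          Set.mem_singleton_iff, Option.some.injEq, mul_one, add_zero, sub_eq_iff_eq_add', or_assoc]
  | some b =>
    have hab' : a ≠ b := fun h => hab (by rw [h])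
    have d1 : 1 - w ≠ 0 := sub_ne_zero.2 hw1.symm
    have d2 : 1 - w ^ 2 ≠ 0 := sub_ne_zero.2 hww.symm
    refine ⟨none, some ((a - w * b) / (1 - w)), some ((a - w ^ 2 * b) / (1 - w ^ 2)),
      by simp, by simp, ?_, ?_⟩
    · intro h
      rw [Option.some.injEq, div_eq_div_iff d1 d2] at h
      have : (a - b) * (w - w ^ 2) = 0 := by linear_combination h
      rcases mul_eq_zero.1 this with h | h
      · exact hab' (sub_eq_zero.1 h)
      · exact hne (sub_eq_zero.1 h)
    · ext s
      cases s with
      | none => simp [brk]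
      | some s =>
        simp only [Set.mem_ofPred_eq, fac, brk, mul_eq_zero, Set.mem_insert_iff,
          Set.mem_singleton_iff, Option.some.injEq, eq_div_iff d1, eq_div_iff d2]
        have : s - a - (s - b) ≠ 0 := fun h => hab' (by linear_combination -h)
        grind

lemma part_one [Fintype F] (h3 : (3 : F) ≠ 0) (h : Fintype.card F % 3 = 1)
    (a : F) (b : Option F) (hab : some a ≠ b) :
    ∃ W, IsThreePlane F W ∧ oscPlane F (some a) ⊓ oscPlane F b ≤ W := by
  obtain ⟨w, hw, hw1⟩ := exists_omega F h
  refine ⟨LinearMap.ker (ofm F (some a) - ofm F b), ⟨?_, ?_⟩, ?_⟩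
  · have hne : ofm F (some a) - ofm F b ≠ 0 := by
      intro h0
      have := congrArg (fun f => f (cvec F (some a))) h0
      simp only [LinearMap.sub_apply, ofm_cvec, LinearMap.zero_apply] at this
      cases b with
      | none => simp [brk] at this
      | some b =>
        simp [brk, sub_eq_zero] at this
        exact hab (by rw [this])
    have := Module.Dual.finrank_ker_add_one_of_ne_zero hne
    simp at this
    omega
  · rw [ptsOn_ker, Set.ncard_image_of_injective _ (span_cvec_inj F)]
    simp only [LinearMap.sub_apply, ofm_cvec]
    exact sol_card F h3 w hw hw1 a b hab
  · rintro x ⟨hx, hy⟩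
    rw [oscPlane_eq] at hx hy
    simp only [SetLike.mem_coe, LinearMap.mem_ker] at hx hy
    simp [hx, hy]

lemma brk_indep (a b s s' : Option F) (hab : a ≠ b) (hs : s ≠ s') (x y : F)
    (h1 : x * brk F a s + y * brk F b s = 0) (h2 : x * brk F a s' + y * brk F b s' = 0) :
    x = 0 ∧ y = 0 := by
  cases a <;> cases b <;> cases s <;> cases s' <;> simp [brk] at hab hs h1 h2 ⊢ <;> grind

lemma part_two [Fintype F] (h : Fintype.card F % 3 = 2) (a b : Option F) (hab : a ≠ b) :
    ¬ ∃ W, IsThreePlane F W ∧ oscPlane F a ⊓ oscPlane F b ≤ W := by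
  rintro ⟨W, ⟨hW, hn⟩, hle⟩
  have hlt : W < ⊤ := by
    rw [lt_top_iff_ne_top]
    rintro rfl
    simp at hW
  obtain ⟨φ, hφ, hWφ⟩ := Submodule.exists_le_ker_of_lt_top W hlt
  have hmem : φ ∈ span F (Set.range ![ofm F a, ofm F b]) := by
    apply mem_span_of_iInf_ker_le_ker
    refine le_trans ?_ (hle.trans hWφ)
    rw [oscPlane_eq, oscPlane_eq]
    exact le_inf (iInf_le _ (0 : Fin 2)) (iInf_le _ (1 : Fin 2))
  rw [Matrix.range_cons, Matrix.range_cons, Matrix.range_empty, Set.union_empty,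
    Set.singleton_union, mem_span_pair] at hmem
  obtain ⟨α, β, rfl⟩ := hmem
  have inj := cube_inj F h
  have surj : Function.Surjective (fun x : F => x ^ 3) := Finite.surjective_of_injective inj
  obtain ⟨x, rfl⟩ := surj α
  obtain ⟨y, rfl⟩ := surj β
  have hfin : (ptsOn F W).Finite := Set.finite_of_ncard_pos (by omega)
  obtain ⟨P, hP, Q, hQ, hPQ⟩ := (Set.one_lt_ncard hfin).1 (by omega : 1 < (ptsOn F W).ncard)
  have tr : ∀ P ∈ ptsOn F W, P ∈ ptsOn F (LinearMap.ker (x ^ 3 • ofm F a + y ^ 3 • ofm F b)) :=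
    fun P hP => ⟨hP.1, hP.2.trans hWφ⟩
  have hP' := tr P hP
  have hQ' := tr Q hQ
  rw [ptsOn_ker] at hP' hQ'
  obtain ⟨s, hs, rfl⟩ := hP'
  obtain ⟨s', hs', rfl⟩ := hQ'
  have lin : ∀ s, (x ^ 3 • ofm F a + y ^ 3 • ofm F b) (cvec F s) = 0 →
      x * brk F a s + y * brk F b s = 0 := by
    intro s hs
    simp only [LinearMap.add_apply, LinearMap.smul_apply, ofm_cvec, smul_eq_mul] at hs
    have : x * brk F a s = -(y * brk F b s) := inj (by
      show (x * brk F a s) ^ 3 = (-(y * brk F b s)) ^ 3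
      linear_combination hs)
    rw [this]; ring
  have hss : s ≠ s' := fun h => hPQ (by rw [h])
  obtain ⟨rfl, rfl⟩ := brk_indep F a b s s' hab hss x y (lin s hs) (lin s' hs')
  simp at hφ

/-- Theorem: let `q ≥ 23` be a power of a prime `p ≠ 3`. If `q ≡ 1 (mod 3)` then every
real axis of `C₃` (intersection of the osculating planes at two distinct points of
`C₃(q)`, the points being indexed by `F ∪ {∞}`) lies in at least one 3-plane; if
`q ≡ 2 (mod 3)` then no real axis lies in any 3-plane. -/
theorem real_axis_three_plane [Fintype F] (h3 : (3 : F) ≠ 0)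
    (h23 : 23 ≤ Fintype.card F) :
    (Fintype.card F % 3 = 1 → ∀ a b : Option F, a ≠ b →
      ∃ W, IsThreePlane F W ∧ oscPlane F a ⊓ oscPlane F b ≤ W) ∧
    (Fintype.card F % 3 = 2 → ∀ a b : Option F, a ≠ b →
      ¬ ∃ W, IsThreePlane F W ∧ oscPlane F a ⊓ oscPlane F b ≤ W) := by
  refine ⟨fun h a b hab => ?_, fun h a b hab => part_two F h a b hab⟩
  cases a with
  | some a => exact part_one F h3 h a b hab
  | none =>
    cases b with
    | none => exact absurd rfl hab
    | some b =>
      rw [inf_comm]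
      exact part_one F h3 h b none (by simp)

end
end

section
/- Let q ≥ 23 be a power of a prime p with p ≠ 3. If q ≡ 2 (mod 3), then every imaginary axis of C_3 is contained in at least one 3-plane; if q ≡ 1 (mod 3), then no imaginary axis of C_3 is contained in any 3-plane. -/
open Submodule Module

noncomputable section

variable (F : Type) [Field F]

/-- The `E`-span of (the extension of scalars of) a subspace of `F⁴`. -/
def extSpan (E : Type) [Field E] [Algebra F E] (L : Submodule F (Fin 4 → F)) :
    Submodule E (Fin 4 → E) :=
  span E (extVec F E '' (L : Set (Fin 4 → F)))

/-- An imaginary axis: a line `L` of `P³(F_q)` whose `F_{q²}`-span is the intersection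
of the osculating planes at the conjugate points `(ξ³ : ξ² : ξ : 1)` and
`(ξ^{3q} : ξ^{2q} : ξ^q : 1)` for some `ξ ∈ F_{q²} ∖ F_q`. -/
def IsImagAxis [Fintype F] (E : Type) [Field E] [Algebra F E]
    (L : Submodule F (Fin 4 → F)) : Prop :=
  finrank F L = 2 ∧ ∃ ξ : E, ξ ∉ Set.range (algebraMap F E) ∧
    extSpan F E L =
      LinearMap.ker (oscForm E ξ) ⊓ LinearMap.ker (oscForm E (ξ ^ Fintype.card F))

/-- Elements fixed by the `q`-Frobenius come from the base field. -/
lemma aux_fixed [Fintype F] (E : Type) [Field E] [Algebra F E] (x : E)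
    (hx : x ^ Fintype.card F = x) : ∃ a : F, algebraMap F E a = x := by
  have hs : (Polynomial.X ^ Fintype.card F - Polynomial.X : Polynomial F).Splits := by
    rw [Polynomial.splits_iff_card_roots, FiniteField.roots_X_pow_card_sub_X,
      FiniteField.X_pow_card_sub_X_natDegree_eq F Fintype.one_lt_card]
    rfl
  exact hs.mem_range_of_isRoot (f := Polynomial.X ^ Fintype.card F - Polynomial.X)
    (FiniteField.X_pow_card_sub_X_ne_zero F Fintype.one_lt_card) (by simp [hx])

/-- Frobenius is an involution on the quadratic extension. -/
lemma aux_invol [Fintype F] (E : Type) [Field E] [Algebra F E]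
    (hE : finrank F E = 2) (x : E) : (x ^ Fintype.card F) ^ Fintype.card F = x := by
  have : Module.Finite F E := Module.finite_of_finrank_pos (by omega)
  have : Finite E := Module.finite_of_finite F
  have := Fintype.ofFinite E
  have hc : Fintype.card E = Fintype.card F ^ 2 := by
    rw [Module.card_eq_pow_finrank (K := F), hE]
  rw [← pow_mul, ← sq, ← hc, FiniteField.pow_card]

lemma aux_omega [Fintype F] (E : Type) [Field E] [Algebra F E]
    (hE : finrank F E = 2) (hq : Fintype.card F % 3 = 2) : ∃ w : E, w ^ 3 = 1 ∧ w ≠ 1 := by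
  have : Module.Finite F E := Module.finite_of_finrank_pos (by omega)
  have : Finite E := Module.finite_of_finite F
  have := Fintype.ofFinite E
  have hc : Fintype.card E = Fintype.card F ^ 2 := by
    rw [Module.card_eq_pow_finrank (K := F), hE]
  classical
  have hd : 3 ∣ Fintype.card Eˣ := by
    rw [Fintype.card_units, hc]
    have : Fintype.card F ^ 2 % 3 = 1 := by rw [Nat.pow_mod, hq]
    omega
  have : Fact (Nat.Prime 3) := ⟨Nat.prime_three⟩
  obtain ⟨w, hw⟩ := exists_prime_orderOf_dvd_card 3 hd
  refine ⟨w, ?_, ?_⟩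
  · have := pow_orderOf_eq_one w
    rw [hw] at this
    rw [← Units.val_pow_eq_pow_val, this, Units.val_one]
  · intro h
    have : w = 1 := Units.ext h
    rw [this, orderOf_one] at hw
    omega

lemma aux_osc (t : F) (v : Fin 4 → F) :
    oscForm F t v = v 0 - 3 * t * v 1 + 3 * t ^ 2 * v 2 - t ^ 3 * v 3 := by
  simp [oscForm]

/-- The plane through the points with parameters `∞, a, b`. -/
def auxForm (a b : F) : (Fin 4 → F) →ₗ[F] F :=
  (LinearMap.proj 1 : (Fin 4 → F) →ₗ[F] F) - (a + b) • (LinearMap.proj 2 : (Fin 4 → F) →ₗ[F] F)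
    + (a * b) • (LinearMap.proj 3 : (Fin 4 → F) →ₗ[F] F)

lemma auxForm_apply (a b : F) (v : Fin 4 → F) :
    auxForm F a b v = v 1 - (a + b) * v 2 + a * b * v 3 := by
  simp [auxForm]

lemma aux_span_inj (a b : F)
    (h : span F {![a ^ 3, a ^ 2, a, 1]} = span F {![b ^ 3, b ^ 2, b, 1]}) : a = b := by
  have h1 : ![a ^ 3, a ^ 2, a, 1] ∈ span F {![b ^ 3, b ^ 2, b, 1]} :=
    h ▸ mem_span_singleton_self _
  obtain ⟨c, hc⟩ := mem_span_singleton.1 h1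
  have e3 := congrFun hc 3
  have e2 := congrFun hc 2
  simp at e3 e2
  rw [← e2, e3, one_mul]

lemma aux_span_inf (a : F)
    (h : span F {![1, 0, 0, 0]} = span F {![a ^ 3, a ^ 2, a, 1]}) : False := by
  have h1 : ![a ^ 3, a ^ 2, a, 1] ∈ span F {![(1 : F), 0, 0, 0]} :=
    h ▸ mem_span_singleton_self _
  obtain ⟨c, hc⟩ := mem_span_singleton.1 h1
  have e3 := congrFun hc 3
  simp at e3

lemma aux_threePlane (a b : F) (hab : a ≠ b) :
    IsThreePlane F (LinearMap.ker (auxForm F a b)) := by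
  constructor
  · have h1 := LinearMap.finrank_range_add_finrank_ker (auxForm F a b)
    have h2 : LinearMap.range (auxForm F a b) = ⊤ := by
      apply LinearMap.range_eq_top.2
      intro x
      exact ⟨![0, x, 0, 0], by simp [auxForm_apply]⟩
    rw [h2, finrank_top, Module.finrank_self, Module.finrank_fin_fun] at h1
    omega
  · rw [Set.ncard_eq_three]
    refine ⟨span F {![1, 0, 0, 0]}, span F {![a ^ 3, a ^ 2, a, 1]},
      span F {![b ^ 3, b ^ 2, b, 1]}, fun h => aux_span_inf F a h, fun h => aux_span_inf F b h,
      fun h => hab (aux_span_inj F a b h), ?_⟩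
    ext P
    simp only [ptsOn, cubicPts, Set.mem_ofPred_eq, Set.mem_insert_iff, Set.mem_singleton_iff]
    constructor
    · rintro ⟨⟨t, rfl⟩ | rfl, h2⟩
      · rw [span_singleton_le_iff_mem, LinearMap.mem_ker, auxForm_apply] at h2
        simp at h2
        have : (t - a) * (t - b) = 0 := by linear_combination h2
        rcases mul_eq_zero.1 this with h | h
        · rw [sub_eq_zero.1 h]; simp
        · rw [sub_eq_zero.1 h]; simp
      · simp
    · rintro (rfl | rfl | rfl)
      · exact ⟨Or.inr rfl, by
          rw [span_singleton_le_iff_mem, LinearMap.mem_ker, auxForm_apply]; simp⟩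
      · exact ⟨Or.inl ⟨_, rfl⟩, by
          rw [span_singleton_le_iff_mem, LinearMap.mem_ker, auxForm_apply]; simp; ring⟩
      · exact ⟨Or.inl ⟨_, rfl⟩, by
          rw [span_singleton_le_iff_mem, LinearMap.mem_ker, auxForm_apply]; simp; ring⟩

lemma aux_part1 [Fintype F] (E : Type) [Field E] [Algebra F E]
    (hE : finrank F E = 2) (h3 : (3 : F) ≠ 0) (hq : Fintype.card F % 3 = 2)
    (L : Submodule F (Fin 4 → F)) (hL : IsImagAxis F E L) :
    ∃ W, IsThreePlane F W ∧ L ≤ W := by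
  obtain ⟨-, ξ, hξ, hspan⟩ := hL
  obtain ⟨w, hw3, hw1⟩ := aux_omega F E hE hq
  have h3E : (3 : E) ≠ 0 := by
    intro h
    apply h3
    apply (algebraMap F E).injective
    rw [map_ofNat, map_zero, h]
  have hfr : ∀ x : E, FiniteField.frobeniusAlgHom F E x = x ^ Fintype.card F := fun x => rfl
  have hww : w ^ 2 + w + 1 = 0 := by
    have : (w - 1) * (w ^ 2 + w + 1) = 0 := by linear_combination hw3
    exact (mul_eq_zero.1 this).resolve_left (sub_ne_zero.2 hw1)
  have hwq : w ^ Fintype.card F = w ^ 2 := by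
    rw [← Nat.div_add_mod (Fintype.card F) 3, hq, pow_add, pow_mul, hw3, one_pow, one_mul]
  have hne : ξ ≠ ξ ^ Fintype.card F := by
    intro h
    exact hξ (aux_fixed F E ξ h.symm)
  have hinv := aux_invol F E hE ξ
  generalize hη : ξ ^ Fintype.card F = η at *
  have hd : (1 : E) - w ≠ 0 := sub_ne_zero.2 (Ne.symm hw1)
  have hd2 : (1 : E) - w ^ 2 ≠ 0 := by
    intro h
    apply hw1
    linear_combination w * h + hw3
  have hfix1 : ((ξ - w * η) / (1 - w)) ^ Fintype.card F = (ξ - w * η) / (1 - w) := by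
    rw [← hfr, map_div₀, map_sub, map_sub, map_mul, map_one, hfr, hfr, hfr, hη, hinv, hwq]
    rw [div_eq_div_iff hd2 hd]
    linear_combination (ξ - η) * hw3
  have hfix2 : ((ξ - w ^ 2 * η) / (1 - w ^ 2)) ^ Fintype.card F
      = (ξ - w ^ 2 * η) / (1 - w ^ 2) := by
    rw [← hfr, map_div₀, map_sub, map_sub, map_mul, map_one, map_pow, hfr, hfr, hfr, hη, hinv, hwq]
    have : (w ^ 2) ^ 2 = w := by linear_combination w * hw3
    rw [this, div_eq_div_iff hd hd2]
    linear_combination (ξ - η) * hw3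
  obtain ⟨a, ha⟩ := aux_fixed F E _ hfix1
  obtain ⟨b, hb⟩ := aux_fixed F E _ hfix2
  have ha' : algebraMap F E a * (1 - w) = ξ - w * η := by rw [ha, div_mul_cancel₀ _ hd]
  have hb' : algebraMap F E b * (1 - w ^ 2) = ξ - w ^ 2 * η := by rw [hb, div_mul_cancel₀ _ hd2]
  have hsum : algebraMap F E a + algebraMap F E b = ξ + η := by
    rw [ha, hb, div_add_div _ _ hd hd2, div_eq_iff (mul_ne_zero hd hd2)]
    linear_combination (η - ξ) * hw3
  have hprod : 3 * (algebraMap F E a * algebraMap F E b) = ξ ^ 2 + ξ * η + η ^ 2 := by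
    rw [ha, hb, div_mul_div_comm, ← mul_div_assoc, div_eq_iff (mul_ne_zero hd hd2)]
    linear_combination (-2 * ξ * η + ξ ^ 2 + η ^ 2) * hww + (-ξ * η - ξ ^ 2 + 2 * η ^ 2) * hw3
  refine ⟨LinearMap.ker (auxForm F a b), aux_threePlane F a b ?_, ?_⟩
  · rintro rfl
    apply hne
    have h1 : w * (1 - w) * (algebraMap F E a - η) = 0 := by
      linear_combination hb' - ha'
    have hw0 : w ≠ 0 := by
      rintro rfl
      simp at hw3
    have h2 := (mul_eq_zero.1 h1).resolve_left (mul_ne_zero hw0 hd)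
    linear_combination (1 - w) * h2 - ha'
  · intro v hv
    have hm : extVec F E v ∈ extSpan F E L := subset_span ⟨v, hv, rfl⟩
    rw [hspan, mem_inf, LinearMap.mem_ker, LinearMap.mem_ker, aux_osc, aux_osc] at hm
    obtain ⟨h1, h2⟩ := hm
    rw [LinearMap.mem_ker, auxForm_apply]
    apply (algebraMap F E).injective
    simp only [extVec] at h1 h2
    simp only [map_add, map_sub, map_mul, map_zero]
    have hk : 3 * (ξ - η) ≠ 0 := mul_ne_zero h3E (sub_ne_zero.2 hne)
    apply (mul_eq_zero.1 _).resolve_left hk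
    rw [hsum]
    linear_combination h2 - h1 + (ξ - η) * algebraMap F E (v 3) * hprod

lemma aux_key [Fintype F] (E : Type) [Field E] [Algebra F E]
    (hE : finrank F E = 2) (hq : Fintype.card F % 3 = 1)
    (L W : Submodule F (Fin 4 → F)) (hL : IsImagAxis F E L) (hW : finrank F W = 3) (hLW : L ≤ W)
    (t s : F) (ht : span F {![t ^ 3, t ^ 2, t, 1]} ≤ W)
    (hs : span F {![s ^ 3, s ^ 2, s, 1]} ≤ W) : t = s := by
  obtain ⟨-, ξ, hξ, hspan⟩ := hL
  have hfr : ∀ x : E, FiniteField.frobeniusAlgHom F E x = x ^ Fintype.card F := fun x => rfl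
  have hne : ξ ≠ ξ ^ Fintype.card F := by
    intro h
    exact hξ (aux_fixed F E ξ h.symm)
  have hinv := aux_invol F E hE ξ
  have hlt : W < ⊤ := by
    rw [lt_top_iff_ne_top]
    rintro rfl
    rw [finrank_top, Module.finrank_fin_fun] at hW
    omega
  obtain ⟨g, hg0, hg⟩ := W.exists_le_ker_of_lt_top hlt
  have hgv : ∀ v, g v = v 0 * g (Pi.single 0 1) + v 1 * g (Pi.single 1 1)
      + v 2 * g (Pi.single 2 1) + v 3 * g (Pi.single 3 1) := by
    intro v
    conv_lhs => rw [pi_eq_sum_univ' v]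
    simp [Fin.sum_univ_four]
  generalize hη : ξ ^ Fintype.card F = η at *
  set G : (Fin 4 → E) →ₗ[E] E :=
    algebraMap F E (g (Pi.single 0 1)) • LinearMap.proj 0
    + algebraMap F E (g (Pi.single 1 1)) • LinearMap.proj 1
    + algebraMap F E (g (Pi.single 2 1)) • LinearMap.proj 2
    + algebraMap F E (g (Pi.single 3 1)) • LinearMap.proj 3 with hG
  have hGe : ∀ v, G (extVec F E v) = algebraMap F E (g v) := by
    intro v
    rw [hgv v]
    simp [hG, extVec, Algebra.smul_def]
    ring
  have hker : LinearMap.ker (oscForm E ξ) ⊓ LinearMap.ker (oscForm E η) ≤ LinearMap.ker G := by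
    rw [← hspan, extSpan, span_le]
    rintro _ ⟨v, hv, rfl⟩
    have : g v = 0 := hg (hLW hv)
    simp [hGe, this]
  have hmem : G ∈ span E (Set.range ![oscForm E ξ, oscForm E η]) := by
    apply mem_span_of_iInf_ker_le_ker
    refine le_trans ?_ hker
    exact le_inf (iInf_le _ (0 : Fin 2)) (iInf_le _ (1 : Fin 2))
  obtain ⟨c, hc⟩ := (mem_span_range_iff_exists_fun E).1 hmem
  simp only [Fin.sum_univ_two, Matrix.cons_val_zero, Matrix.cons_val_one] at hc
  have hcube : ∀ r : F, span F {![r ^ 3, r ^ 2, r, 1]} ≤ W →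
      c 0 * (algebraMap F E r - ξ) ^ 3 + c 1 * (algebraMap F E r - η) ^ 3 = 0 := by
    intro r hr
    have h0 : g ![r ^ 3, r ^ 2, r, 1] = 0 := hg (hr (mem_span_singleton_self _))
    have h1 := hGe ![r ^ 3, r ^ 2, r, 1]
    rw [h0, ← hc] at h1
    simp [aux_osc, extVec] at h1
    linear_combination h1
  have e1 := hcube t ht
  have e2 := hcube s hs
  have hroot : ∀ r : F, algebraMap F E r - ξ ≠ 0 := fun r h => hξ ⟨r, sub_eq_zero.1 h⟩
  have hconj : ∀ r : F, (algebraMap F E r - ξ) ^ Fintype.card F = algebraMap F E r - η := by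
    intro r
    rw [← hfr, map_sub, AlgHom.commutes, hfr, hη]
  have hconj' : ∀ r : F, (algebraMap F E r - η) ^ Fintype.card F = algebraMap F E r - ξ := by
    intro r
    rw [← hfr, map_sub, AlgHom.commutes, hfr, hinv]
  have hroot' : ∀ r : F, algebraMap F E r - η ≠ 0 := by
    intro r h
    apply hroot r
    rw [← hconj' r, h, zero_pow Fintype.card_ne_zero]
  have hcne : c 0 ≠ 0 := by
    intro h0
    rw [h0, zero_mul, zero_add] at e1
    have h1 : c 1 = 0 := (mul_eq_zero.1 e1).resolve_right (pow_ne_zero _ (hroot' t))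
    have hG0 : G = 0 := by rw [← hc, h0, h1]; simp
    apply hg0
    ext v
    apply (algebraMap F E).injective
    simp only [LinearMap.coe_comp, Function.comp_apply]
    rw [← hGe, hG0]
    simp
  have hAB : ((algebraMap F E t - ξ) * (algebraMap F E s - η)) ^ 3
      = ((algebraMap F E t - η) * (algebraMap F E s - ξ)) ^ 3 := by
    apply mul_left_cancel₀ hcne
    linear_combination (algebraMap F E s - η) ^ 3 * e1 - (algebraMap F E t - η) ^ 3 * e2
  have hA0 : (algebraMap F E t - ξ) * (algebraMap F E s - η) ≠ 0 :=
    mul_ne_zero (hroot t) (hroot' s)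
  have hB0 : (algebraMap F E t - η) * (algebraMap F E s - ξ) ≠ 0 :=
    mul_ne_zero (hroot' t) (hroot s)
  have hAq : ((algebraMap F E t - ξ) * (algebraMap F E s - η)) ^ Fintype.card F
      = (algebraMap F E t - η) * (algebraMap F E s - ξ) := by
    rw [mul_pow, hconj, hconj']
  have hBq : ((algebraMap F E t - η) * (algebraMap F E s - ξ)) ^ Fintype.card F
      = (algebraMap F E t - ξ) * (algebraMap F E s - η) := by
    rw [mul_pow, hconj, hconj']
  have hAB1 : (algebraMap F E t - ξ) * (algebraMap F E s - η)
      = (algebraMap F E t - η) * (algebraMap F E s - ξ) := by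
    generalize (algebraMap F E t - ξ) * (algebraMap F E s - η) = A at *
    generalize (algebraMap F E t - η) * (algebraMap F E s - ξ) = B at *
    have hz3 : (B / A) ^ 3 = 1 := by
      rw [div_pow, hAB, div_self (pow_ne_zero _ hB0)]
    have hzq : (B / A) ^ Fintype.card F = A / B := by rw [div_pow, hAq, hBq]
    rw [← Nat.div_add_mod (Fintype.card F) 3, hq, pow_add, pow_mul, hz3, one_pow, one_mul,
      pow_one, div_eq_div_iff hA0 hB0] at hzq
    -- B * B = A * A, so A^3 = B^3 gives A = B
    have : A ^ 2 * (A - B) = 0 := by linear_combination hAB + B * hzq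
    exact sub_eq_zero.1 ((mul_eq_zero.1 this).resolve_left (pow_ne_zero _ hA0))
  apply (algebraMap F E).injective
  have : (ξ - η) * (algebraMap F E t - algebraMap F E s) = 0 := by linear_combination hAB1
  exact sub_eq_zero.1 ((mul_eq_zero.1 this).resolve_left (sub_ne_zero.2 hne))

lemma aux_part2 [Fintype F] (E : Type) [Field E] [Algebra F E]
    (hE : finrank F E = 2) (hq : Fintype.card F % 3 = 1)
    (L : Submodule F (Fin 4 → F)) (hL : IsImagAxis F E L) :
    ¬ ∃ W, IsThreePlane F W ∧ L ≤ W := by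
  rintro ⟨W, ⟨hW, hcard⟩, hLW⟩
  obtain ⟨P, Q, R, hPQ, hPR, hQR, hset⟩ := Set.ncard_eq_three.1 hcard
  have key := aux_key F E hE hq L W hL hW hLW
  have hP : P ∈ ptsOn F W := by rw [hset]; simp
  have hQ : Q ∈ ptsOn F W := by rw [hset]; simp
  have hR : R ∈ ptsOn F W := by rw [hset]; simp
  obtain ⟨hP1 | hP1, hP2⟩ := hP <;> obtain ⟨hQ1 | hQ1, hQ2⟩ := hQ <;>
    obtain ⟨hR1 | hR1, hR2⟩ := hR
  all_goals first
    | exact hPQ (hP1.trans hQ1.symm)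
    | exact hPR (hP1.trans hR1.symm)
    | exact hQR (hQ1.trans hR1.symm)
    | (obtain ⟨t, rfl⟩ := hP1; obtain ⟨s, rfl⟩ := hQ1
       exact hPQ (by rw [key t s hP2 hQ2]))
    | (obtain ⟨t, rfl⟩ := hP1; obtain ⟨s, rfl⟩ := hR1
       exact hPR (by rw [key t s hP2 hR2]))
    | (obtain ⟨t, rfl⟩ := hQ1; obtain ⟨s, rfl⟩ := hR1
       exact hQR (by rw [key t s hQ2 hR2]))

/-- Theorem: let `q ≥ 23` be a power of a prime `p ≠ 3`. If `q ≡ 2 (mod 3)` then every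
imaginary axis of `C₃` lies in at least one 3-plane; if `q ≡ 1 (mod 3)` then no
imaginary axis lies in any 3-plane. Here `E` is the quadratic extension `F_{q²}`. -/
theorem imag_axis_three_plane [Fintype F] (E : Type) [Field E] [Algebra F E]
    (hE : finrank F E = 2) (h3 : (3 : F) ≠ 0) (h23 : 23 ≤ Fintype.card F) :
    (Fintype.card F % 3 = 2 → ∀ L : Submodule F (Fin 4 → F), IsImagAxis F E L →
      ∃ W, IsThreePlane F W ∧ L ≤ W) ∧
    (Fintype.card F % 3 = 1 → ∀ L : Submodule F (Fin 4 → F), IsImagAxis F E L →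
      ¬ ∃ W, IsThreePlane F W ∧ L ≤ W) := 
  ⟨fun hq L hL => aux_part1 F E hE h3 hq L hL, fun hq L hL => aux_part2 F E hE hq L hL⟩


end
end

section
/- Let q ≥ 23 be a prime power. Every line of P^3(F_q) that contains exactly one point of C_3(q) and is not contained in any osculating plane of C_3 is contained in at least one 3-plane. -/
open Submodule Module

noncomputable section

variable (F : Type) [Field F]

variable {F} in
lemma mem_w {t : F} {W : Submodule F (Fin 4 → F)} :
    span F {![t ^ 3, t ^ 2, t, 1]} ≤ W ↔ ![t ^ 3, t ^ 2, t, 1] ∈ W := by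
  rw [span_singleton_le_iff_mem]

variable {F} in
lemma span_w_inj {t t' : F} (h : span F {![t ^ 3, t ^ 2, t, 1]} = span F {![t' ^ 3, t' ^ 2, t', 1]}) :
    t = t' := by
  have h' : ![t ^ 3, t ^ 2, t, 1] ∈ span F {![t' ^ 3, t' ^ 2, t', 1]} := h ▸ mem_span_singleton_self _
  obtain ⟨c, hc⟩ := mem_span_singleton.1 h'
  have h3 := congrFun hc 3
  have h2 := congrFun hc 2
  simp at h3 h2
  rw [← h2, h3, one_mul]

variable {F} in
lemma span_w_ne {t : F} : span F {![t ^ 3, t ^ 2, t, 1]} ≠ span F {![1, 0, 0, 0]} := by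
  intro h
  have h' : ![t ^ 3, t ^ 2, t, 1] ∈ span F {![(1 : F), 0, 0, 0]} := h ▸ mem_span_singleton_self _
  obtain ⟨c, hc⟩ := mem_span_singleton.1 h'
  have h3 := congrFun hc 3
  simp at h3

/-- The case where the point is `(1:0:0:0)`. -/
lemma base_case [Fintype F] (h23 : 23 ≤ Fintype.card F)
    (L : Submodule F (Fin 4 → F)) (hL : finrank F L = 2)
    (hP : ![1, 0, 0, 0] ∈ L)
    (hw : ∀ t : F, ![t ^ 3, t ^ 2, t, 1] ∉ L)
    (h2 : ¬ L ≤ LinearMap.ker (LinearMap.proj 3 : (Fin 4 → F) →ₗ[F] F)) :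
    ∃ W, IsThreePlane F W ∧ L ≤ W := by
  classical
  obtain ⟨x, hx, hx3⟩ := SetLike.not_le_iff_exists.1 h2
  have hx3 : x 3 ≠ 0 := by simpa using hx3
  obtain ⟨p, s, hv⟩ : ∃ p s : F, ![0, p, s, 1] ∈ L := by
    refine ⟨(x 3)⁻¹ * x 1, (x 3)⁻¹ * x 2, ?_⟩
    have := L.sub_mem (L.smul_mem (x 3)⁻¹ hx) (L.smul_mem ((x 3)⁻¹ * x 0) hP)
    convert this using 1
    ext i
    fin_cases i <;> simp [hx3]
  have hLs : span F {![1, 0, 0, 0], ![0, p, s, 1]} = L := by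
    apply Submodule.eq_of_le_of_finrank_eq
    · rw [span_le]
      rintro y (rfl | rfl)
      · exact hP
      · exact hv
    · rw [hL]
      have hli : LinearIndependent F ![![1, 0, 0, 0], ![0, p, s, 1]] := by
        rw [LinearIndependent.pair_iff]
        intro a b hab
        have h0 := congrFun hab 0
        have h3 := congrFun hab 3
        simp at h0 h3
        exact ⟨h0, h3⟩
      have := finrank_span_eq_card hli
      rw [Matrix.range_cons_cons_empty] at this
      simpa using this
  have hk : s ^ 2 - p ≠ 0 := by
    intro hk
    apply hw s
    have hp : p = s ^ 2 := by linear_combination -hk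
    have := L.add_mem (L.smul_mem (s ^ 3) hP) hv
    convert this using 1
    ext i
    fin_cases i <;> simp [hp]
  set k := s ^ 2 - p with hkdef
  obtain ⟨u, hu0, huk⟩ : ∃ u : F, u ≠ 0 ∧ u ^ 2 ≠ k := by
    by_contra! hcon
    have hsub : (Finset.univ : Finset F) ⊆ insert 0 (Polynomial.nthRootsFinset 2 k) := by
      intro u _
      by_cases hu : u = 0
      · simp [hu]
      · rw [Finset.mem_insert, Polynomial.mem_nthRootsFinset (by norm_num)]
        exact Or.inr (hcon u hu)
    have h1 := Finset.card_le_card hsub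
    have h2 := Finset.card_insert_le (0 : F) (Polynomial.nthRootsFinset 2 k)
    have h3 : (Polynomial.nthRootsFinset 2 k).card ≤ 2 := by
      rw [Polynomial.nthRootsFinset_def]
      exact (Multiset.toFinset_card_le _).trans (Polynomial.card_nthRoots 2 k)
    rw [Finset.card_univ] at h1
    omega
  set u' := k / u with hu'
  have huu : u * u' = k := by rw [hu']; field_simp
  have hne : u ≠ u' := by
    intro h
    apply huk
    rw [← huu, ← h]; ring
  let φ : (Fin 4 → F) →ₗ[F] F :=
    (LinearMap.proj 1 : (Fin 4 → F) →ₗ[F] F)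
      - (2 * s + u + u') • (LinearMap.proj 2 : (Fin 4 → F) →ₗ[F] F)
      + ((s + u) * (s + u')) • (LinearMap.proj 3 : (Fin 4 → F) →ₗ[F] F)
  have hφ : ∀ y, φ y = y 1 - (2 * s + u + u') * y 2 + ((s + u) * (s + u')) * y 3 := by
    intro y; simp [φ]
  have hφw : ∀ t : F, φ ![t ^ 3, t ^ 2, t, 1] = (t - (s + u)) * (t - (s + u')) := by
    intro t; rw [hφ]; simp; ring
  refine ⟨LinearMap.ker φ, ⟨?_, ?_⟩, ?_⟩
  · have hsurj : Function.Surjective φ := by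
      intro c
      refine ⟨![0, c, 0, 0], ?_⟩
      rw [hφ]; simp
    have h := LinearMap.finrank_range_add_finrank_ker φ
    rw [LinearMap.range_eq_top.2 hsurj] at h
    simp at h
    omega
  · have : ptsOn F (LinearMap.ker φ) = {span F {![1, 0, 0, 0]},
        span F {![(s + u) ^ 3, (s + u) ^ 2, s + u, 1]},
        span F {![(s + u') ^ 3, (s + u') ^ 2, s + u', 1]}} := by
      ext P
      simp only [ptsOn, cubicPts, Set.mem_ofPred_eq, Set.mem_insert_iff, Set.mem_singleton_iff]
      constructor
      · rintro ⟨⟨t, rfl⟩ | rfl, hle⟩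
        · rw [mem_w, LinearMap.mem_ker, hφw, mul_eq_zero, sub_eq_zero, sub_eq_zero] at hle
          rcases hle with rfl | rfl
          · exact Or.inr (Or.inl rfl)
          · exact Or.inr (Or.inr rfl)
        · exact Or.inl rfl
      · rintro (rfl | rfl | rfl)
        · refine ⟨Or.inr rfl, ?_⟩
          rw [span_singleton_le_iff_mem, LinearMap.mem_ker, hφ]
          simp
        · refine ⟨Or.inl ⟨_, rfl⟩, ?_⟩
          rw [mem_w, LinearMap.mem_ker, hφw]; ring
        · refine ⟨Or.inl ⟨_, rfl⟩, ?_⟩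
          rw [mem_w, LinearMap.mem_ker, hφw]; ring
    rw [this, Set.ncard_eq_three]
    refine ⟨_, _, _, span_w_ne.symm, span_w_ne.symm, ?_, rfl⟩
    intro h
    exact hne (add_left_cancel (span_w_inj h))
  · rw [← hLs, span_le]
    rintro y (rfl | rfl)
    · rw [SetLike.mem_coe, LinearMap.mem_ker, hφ]; simp
    · rw [SetLike.mem_coe, LinearMap.mem_ker, hφ]
      simp
      linear_combination huu + hkdef

/-- The projectivity sending the point with parameter `a` to `(1:0:0:0)`. -/
def moveEquiv (a : F) : (Fin 4 → F) ≃ₗ[F] (Fin 4 → F) where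
  toFun x := ![x 3, x 2 - a * x 3, x 1 - 2 * a * x 2 + a ^ 2 * x 3,
    x 0 - 3 * a * x 1 + 3 * a ^ 2 * x 2 - a ^ 3 * x 3]
  invFun y := ![y 3 + 3 * a * y 2 + 3 * a ^ 2 * y 1 + a ^ 3 * y 0,
    y 2 + 2 * a * y 1 + a ^ 2 * y 0, y 1 + a * y 0, y 0]
  map_add' x y := by
    ext i
    fin_cases i <;> simp <;> ring
  map_smul' c x := by
    ext i
    fin_cases i <;> simp <;> ring
  left_inv x := by
    ext i
    fin_cases i <;> simp <;> ring
  right_inv y := by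
    ext i
    fin_cases i <;> simp <;> ring

lemma moveEquiv_apply (a : F) (x : Fin 4 → F) : moveEquiv F a x =
  ![x 3, x 2 - a * x 3, x 1 - 2 * a * x 2 + a ^ 2 * x 3,
    x 0 - 3 * a * x 1 + 3 * a ^ 2 * x 2 - a ^ 3 * x 3] := rfl

lemma move_self (a : F) : moveEquiv F a ![a ^ 3, a ^ 2, a, 1] = ![1, 0, 0, 0] := by
  rw [moveEquiv_apply]
  ext i
  fin_cases i <;> simp <;> ring

lemma move_inf (a : F) : moveEquiv F a ![1, 0, 0, 0] = ![0 ^ 3, 0 ^ 2, 0, 1] := by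
  rw [moveEquiv_apply]
  ext i
  fin_cases i <;> simp

lemma move_other (a s : F) (hs : s ≠ 0) :
    moveEquiv F a ![(a + s⁻¹) ^ 3, (a + s⁻¹) ^ 2, a + s⁻¹, 1]
      = (s⁻¹) ^ 3 • ![s ^ 3, s ^ 2, s, 1] := by
  rw [moveEquiv_apply]
  ext i
  fin_cases i <;> simp <;> field_simp <;> ring

lemma map_other (a s : F) (hs : s ≠ 0) :
    (span F {![(a + s⁻¹) ^ 3, (a + s⁻¹) ^ 2, a + s⁻¹, 1]}).map
      (moveEquiv F a : (Fin 4 → F) →ₗ[F] (Fin 4 → F)) = span F {![s ^ 3, s ^ 2, s, 1]} := by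
  rw [map_span, Set.image_singleton, LinearEquiv.coe_coe, move_other F a s hs]
  exact span_singleton_smul_eq (IsUnit.mk0 _ (pow_ne_zero _ (inv_ne_zero hs))) _

lemma map_cubic (a : F) : (fun P : Submodule F (Fin 4 → F) =>
    P.map (moveEquiv F a : (Fin 4 → F) →ₗ[F] (Fin 4 → F))) '' cubicPts F = cubicPts F := by
  ext Q
  constructor
  · rintro ⟨P, ⟨t, rfl⟩ | rfl, rfl⟩
    · by_cases hta : t = a
      · subst hta
        right
        simp only [map_span, Set.image_singleton, LinearEquiv.coe_coe, move_self]
      · left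
        refine ⟨(t - a)⁻¹, ?_⟩
        have := map_other F a (t - a)⁻¹ (inv_ne_zero (sub_ne_zero.2 hta))
        rw [inv_inv, add_sub_cancel] at this
        exact this
    · left
      refine ⟨0, ?_⟩
      simp only [map_span, Set.image_singleton, LinearEquiv.coe_coe, move_inf]
  · rintro (⟨s, rfl⟩ | rfl)
    · by_cases hs : s = 0
      · subst hs
        refine ⟨_, Or.inr rfl, ?_⟩
        simp only [map_span, Set.image_singleton, LinearEquiv.coe_coe, move_inf]
      · exact ⟨_, Or.inl ⟨_, rfl⟩, map_other F a s hs⟩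
    · refine ⟨_, Or.inl ⟨a, rfl⟩, ?_⟩
      simp only [map_span, Set.image_singleton, LinearEquiv.coe_coe, move_self]

lemma map_inj (a : F) : Function.Injective (fun P : Submodule F (Fin 4 → F) =>
    P.map (moveEquiv F a : (Fin 4 → F) →ₗ[F] (Fin 4 → F))) :=
  Submodule.map_injective_of_injective (moveEquiv F a).injective

lemma map_ptsOn (a : F) (W : Submodule F (Fin 4 → F)) :
    (fun P : Submodule F (Fin 4 → F) =>
      P.map (moveEquiv F a : (Fin 4 → F) →ₗ[F] (Fin 4 → F))) '' ptsOn F W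
      = ptsOn F (W.map (moveEquiv F a : (Fin 4 → F) →ₗ[F] (Fin 4 → F))) := by
  ext Q
  constructor
  · rintro ⟨P, ⟨hP, hle⟩, rfl⟩
    exact ⟨map_cubic F a ▸ ⟨P, hP, rfl⟩, Submodule.map_mono hle⟩
  · rintro ⟨hQ, hle⟩
    rw [← map_cubic F a] at hQ
    obtain ⟨P, hP, rfl⟩ := hQ
    exact ⟨P, ⟨hP, (Submodule.map_le_map_iff_of_injective (moveEquiv F a).injective _ _).1 hle⟩, rfl⟩

/-- The base case restated with `ptsOn`. -/
lemma base_case' [Fintype F] (h23 : 23 ≤ Fintype.card F)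
    (L : Submodule F (Fin 4 → F)) (hL : finrank F L = 2)
    (h1 : ptsOn F L = {span F {![1, 0, 0, 0]}})
    (h2 : ¬ L ≤ LinearMap.ker (LinearMap.proj 3 : (Fin 4 → F) →ₗ[F] F)) :
    ∃ W, IsThreePlane F W ∧ L ≤ W := by
  have hP : span F {![1, 0, 0, 0]} ∈ ptsOn F L := by rw [h1]; rfl
  refine base_case F h23 L hL ((span_singleton_le_iff_mem _ _).1 hP.2) ?_ h2
  intro t ht
  have : span F {![t ^ 3, t ^ 2, t, 1]} ∈ ptsOn F L := ⟨Or.inl ⟨t, rfl⟩, mem_w.2 ht⟩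
  rw [h1] at this
  exact span_w_ne this

/-- Theorem: for `q ≥ 23`, every line of `P³(F_q)` containing exactly one point of
`C₃(q)` and not contained in any osculating plane lies in at least one 3-plane. -/
theorem unisecant_not_in_osc_plane [Fintype F] (h23 : 23 ≤ Fintype.card F)
    (L : Submodule F (Fin 4 → F)) (hL : finrank F L = 2)
    (h1 : (ptsOn F L).ncard = 1)
    (h2 : ∀ a : Option F, ¬ L ≤ oscPlane F a) :
    ∃ W, IsThreePlane F W ∧ L ≤ W := by
  obtain ⟨P, hP⟩ := Set.ncard_eq_one.1 h1
  have hPm : P ∈ ptsOn F L := by rw [hP]; rfl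
  rcases hPm.1 with ⟨a, rfl⟩ | rfl
  · let e := moveEquiv F a
    obtain ⟨W, ⟨hW3, hWn⟩, hLW⟩ := base_case' F h23
      (L.map (e : (Fin 4 → F) →ₗ[F] (Fin 4 → F)))
      (by rw [← hL]; exact LinearEquiv.finrank_map_eq e L)
      (by
        rw [← map_ptsOn, hP, Set.image_singleton]
        simp only [map_span, Set.image_singleton, LinearEquiv.coe_coe, move_self])
      (by
        intro hle
        apply h2 (some a)
        intro x hx
        have := hle (Submodule.mem_map_of_mem hx)
        simpa [e, moveEquiv_apply, oscPlane, oscForm] using this)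
    obtain ⟨V, rfl⟩ : ∃ V : Submodule F (Fin 4 → F),
        V.map (e : (Fin 4 → F) →ₗ[F] (Fin 4 → F)) = W :=
      ⟨W.comap (e : (Fin 4 → F) →ₗ[F] (Fin 4 → F)),
        Submodule.map_comap_eq_of_surjective e.surjective W⟩
    refine ⟨V, ⟨?_, ?_⟩, ?_⟩
    · rw [← hW3]; exact (LinearEquiv.finrank_map_eq e V).symm
    · rw [← hWn, ← map_ptsOn, Set.ncard_image_of_injective _ (map_inj F a)]
    · exact (Submodule.map_le_map_iff_of_injective e.injective _ _).1 hLW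
  · exact base_case' F h23 L hL hP (h2 none)

end
end
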